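/- Let T be an NTP₂ theory and let M be a small model (elementary substructure of the monster model). Then for every formula φ(x,a) with parameters a, φ(x,a) forks over M if and only if φ(x,a) divides over M. -/

import Mathlib

open FirstOrder

universe u

namespace ForkingNTP2

variable (L : FirstOrder.Language.{u, u}) (M : Type u) [L.Structure M]

/-- Two tuples have the same (complete) type over the parameter set `A`,
computed in the monster model `M`. -/
def EqTypeOver (A : Set M) {δ : Type*} (a b : δ → M) : Prop :=
  ∀ (γ : Type u) (φ : L.Formula (δ ⊕ γ)) (c : γ → M), Set.range c ⊆ A →
    (φ.Realize (Sum.elim a c) ↔ φ.Realize (Sum.elim b c))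

/-- The family of formulas `φ(x, bs i)`, `i < ω`, is `k`-inconsistent: every
`k`-element subset is inconsistent. -/
def KInconsistent {α β : Type*} (k : ℕ) (φ : L.Formula (α ⊕ β)) (bs : ℕ → β → M) : Prop :=
  ∀ s : Finset ℕ, s.card = k → ¬ ∃ x : α → M, ∀ i ∈ s, φ.Realize (Sum.elim x (bs i))

/-- `φ(x, b)` `k`-divides over `A`. -/
def KDivides {α β : Type*} (A : Set M) (k : ℕ) (φ : L.Formula (α ⊕ β)) (b : β → M) : Prop :=
  ∃ bs : ℕ → β → M, (∀ i, EqTypeOver L M A (bs i) b) ∧ KInconsistent L M k φ bs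

/-- `φ(x, b)` divides over `A`. -/
def Divides {α β : Type*} (A : Set M) (φ : L.Formula (α ⊕ β)) (b : β → M) : Prop :=
  ∃ k, KDivides L M A k φ b

/-- `φ(x, b)` forks over `A`: it implies a finite disjunction of formulas,
each of which divides over `A`. -/
def Forks {α β : Type*} (A : Set M) (φ : L.Formula (α ⊕ β)) (b : β → M) : Prop :=
  ∃ (n : ℕ) (γ : Fin n → Type u) (ψ : ∀ i, L.Formula (α ⊕ γ i)) (c : ∀ i, γ i → M),
    (∀ i, Divides L M A (ψ i) (c i)) ∧
    ∀ x : α → M, φ.Realize (Sum.elim x b) → ∃ i, (ψ i).Realize (Sum.elim x (c i))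

/-- The complete type `tp(a / P)` forks over `A`: some formula with parameters
in `P` satisfied by `a` forks over `A`. -/
def TpForks {α : Type*} (A : Set M) (a : α → M) (P : Set M) : Prop :=
  ∃ (γ : Type u) (φ : L.Formula (α ⊕ γ)) (b : γ → M),
    Set.range b ⊆ P ∧ φ.Realize (Sum.elim a b) ∧ Forks L M A φ b

/-- `φ(x, e)` quasi divides over `A`: finitely many `A`-conjugates of `e` make
the corresponding instances inconsistent. -/
def QuasiDivides {α ε : Type*} (A : Set M) (φ : L.Formula (α ⊕ ε)) (e : ε → M) : Prop :=
  ∃ (m : ℕ) (es : Fin m → ε → M), (∀ j, EqTypeOver L M A (es j) e) ∧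
    ¬ ∃ x : α → M, ∀ j, φ.Realize (Sum.elim x (es j))

/-- `f` is an `A`-indiscernible sequence (of `β`-tuples). -/
def IndiscSeq {β : Type*} (A : Set M) (f : ℕ → β → M) : Prop :=
  ∀ (n : ℕ) (g h : Fin n → ℕ), StrictMono g → StrictMono h →
    EqTypeOver L M A (fun p : Fin n × β => f (g p.1) p.2)
      (fun p : Fin n × β => f (h p.1) p.2)

/-- The automorphism `σ` fixes the set `A` pointwise. -/
def FixesSet (σ : M ≃[L] M) (A : Set M) : Prop := ∀ a ∈ A, σ a = a

/-- `σ` is a Lascar strong automorphism over `A`: a finite product of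
automorphisms, each fixing pointwise some small model containing `A`. -/
def IsLascarStrong (κ : Cardinal.{u}) (A : Set M) (σ : M ≃[L] M) : Prop :=
  ∃ l : List (M ≃[L] M),
    (∀ τ ∈ l, ∃ N : L.ElementarySubstructure M,
      Cardinal.mk (N : Set M) < κ ∧ A ⊆ (N : Set M) ∧ FixesSet L M τ (N : Set M)) ∧
    σ = l.foldr (fun τ ρ => τ.comp ρ) (Language.Equiv.refl L M)

/-- A complete global type in variables `α`: a complete, finitely satisfiable
(in the monster) collection of formulas `φ(x, b)` with parameters `b` in `M`. -/
structure GType (α : Type u) where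
  mem : L.Formula (α ⊕ ℕ) → (ℕ → M) → Prop
  finsat : ∀ l : List (L.Formula (α ⊕ ℕ) × (ℕ → M)),
    (∀ q ∈ l, mem q.1 q.2) → ∃ x : α → M, ∀ q ∈ l, q.1.Realize (Sum.elim x q.2)
  complete : ∀ φ b, mem φ b ∨ mem φ.not b

/-- `c` realizes the restriction `p|C` of the global type `p`. -/
def GType.RealizesRestr {α : Type u} (p : GType L M α) (C : Set M) (c : α → M) : Prop :=
  ∀ (φ : L.Formula (α ⊕ ℕ)) (b : ℕ → M), p.mem φ b → Set.range b ⊆ C →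
    φ.Realize (Sum.elim c b)

/-- The global type `p` extends `tp(a / C)`. -/
def GType.Extends {α : Type u} (p : GType L M α) (a : α → M) (C : Set M) : Prop :=
  ∀ (φ : L.Formula (α ⊕ ℕ)) (b : ℕ → M), Set.range b ⊆ C →
    φ.Realize (Sum.elim a b) → p.mem φ b

/-- The global type `p` is invariant under the automorphism `σ`. -/
def GType.InvUnder {α : Type u} (p : GType L M α) (σ : M ≃[L] M) : Prop :=
  ∀ φ b, p.mem φ b ↔ p.mem φ (fun i => σ (b i))

/-- The global type `p` is (strongly) Lascar invariant over `A`. -/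
def GType.LascarInv {α : Type u} (κ : Cardinal.{u}) (A : Set M) (p : GType L M α) : Prop :=
  ∀ σ : M ≃[L] M, IsLascarStrong L M κ A σ → GType.InvUnder L M p σ

/-- The global type `p` forks over `A`. -/
def GType.ForksOver {α : Type u} (p : GType L M α) (A : Set M) : Prop :=
  ∃ (φ : L.Formula (α ⊕ ℕ)) (b : ℕ → M), p.mem φ b ∧ Forks L M A φ b

/-- `a ⫝ⁱ_A B`: `tp(a / A ∪ B)` has a global extension which is Lascar
invariant over `A`. -/
def IIndep (κ : Cardinal.{u}) {α : Type u} (A : Set M) (a : α → M) (B : Set M) : Prop :=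
  ∃ p : GType L M α, GType.Extends L M p a (A ∪ B) ∧ GType.LascarInv L M κ A p

/-- `a ⫝ⁱˢᵗ_A B`: `tp(a / A ∪ B)` has a global extension `p` which is Lascar
invariant over `A` and such that for every `C ⊇ A` and every `c ⊨ p|C`,
`tp(C / A ∪ c)` does not fork over `A` (strict invariance). -/
def IstIndep (κ : Cardinal.{u}) {α : Type u} (A : Set M) (a : α → M) (B : Set M) : Prop :=
  ∃ p : GType L M α, GType.Extends L M p a (A ∪ B) ∧ GType.LascarInv L M κ A p ∧
    ∀ C : Set M, A ⊆ C → ∀ c : α → M, GType.RealizesRestr L M p C c →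
      ¬ TpForks L M A (fun x : C => (x : M)) (A ∪ Set.range c)

/-- `T` has the tree property of the second kind. -/
def TP2 : Prop :=
  ∃ (n m k : ℕ) (φ : L.Formula ((Fin n : Type) ⊕ (Fin m : Type))) (a : ℕ → ℕ → Fin m → M),
    (∀ j : ℕ, KInconsistent L M k φ (fun i => a i j)) ∧
    ∀ f : ℕ → ℕ, ∃ x : Fin n → M, ∀ j : ℕ, φ.Realize (Sum.elim x (a (f j) j))

/-- `T` is NTP₂. -/
def NTP2 : Prop := ¬ TP2 L M

/-- `T` is dependent (NIP): no formula has the independence property. -/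
def IsNIP : Prop :=
  ¬ ∃ (n m : ℕ) (φ : L.Formula ((Fin n : Type) ⊕ (Fin m : Type)))
      (a : ℕ → Fin n → M) (b : Set ℕ → Fin m → M),
    ∀ (i : ℕ) (u : Set ℕ), φ.Realize (Sum.elim (a i) (b u)) ↔ i ∈ u

/-- Forking equals dividing over `A`. -/
def ForkEqDiv (A : Set M) : Prop :=
  ∀ (α β : Type u) (φ : L.Formula (α ⊕ β)) (b : β → M), Forks L M A φ b → Divides L M A φ b

/-- `A` is an extension base for non-forking: no type over `A` forks over `A`. -/
def ForkingExtBase (A : Set M) : Prop := ∀ (α : Type u) (a : α → M), ¬ TpForks L M A a A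

/-- Non-forking has left extension over `A`. -/
def ForkingLeftExt (A : Set M) : Prop :=
  ∀ (α δ β : Type u) (a : α → M) (bb : β → M) (d : α ⊕ δ → M), d ∘ Sum.inl = a →
    ¬ TpForks L M A a (A ∪ Set.range bb) →
    ∃ d' : α ⊕ δ → M, EqTypeOver L M (A ∪ Set.range a) d' d ∧
      ¬ TpForks L M A d' (A ∪ Set.range bb)

/-- `M` is a monster model (κ-saturated and strongly κ-homogeneous). -/
structure IsMonster (κ : Cardinal.{u}) : Prop where
  aleph0_lt : Cardinal.aleph0 < κ
  saturated : ∀ (A : Set M), Cardinal.mk A < κ → ∀ (α : Type u), Cardinal.mk α < κ →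
    ∀ S : Set (L.Formula (α ⊕ ℕ) × (ℕ → M)),
      (∀ q ∈ S, Set.range q.2 ⊆ A) →
      (∀ l : List (L.Formula (α ⊕ ℕ) × (ℕ → M)), (∀ q ∈ l, q ∈ S) →
        ∃ x : α → M, ∀ q ∈ l, q.1.Realize (Sum.elim x q.2)) →
      ∃ x : α → M, ∀ q ∈ S, q.1.Realize (Sum.elim x q.2)
  homogeneous : ∀ (A : Set M), Cardinal.mk A < κ → ∀ (α : Type u), Cardinal.mk α < κ →
    ∀ a b : α → M, EqTypeOver L M A a b →
      ∃ σ : M ≃[L] M, FixesSet L M σ A ∧ ∀ i, σ (a i) = b i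

/-- An abstract pre-independence relation `R A C B` (read `A ⫝_C B`) satisfying
properties (1)-(7): invariance, monotonicity, base monotonicity, right
extension, transitivity on the left, being stronger than invariance, and
preservation of indiscernibles. -/
structure PreIndep (κ : Cardinal.{u}) (R : Set M → Set M → Set M → Prop) : Prop where
  invariance : ∀ (σ : M ≃[L] M) (A C B : Set M),
    R A C B → R ((fun x => σ x) '' A) ((fun x => σ x) '' C) ((fun x => σ x) '' B)
  monotone : ∀ A A' C B B' : Set M, A' ⊆ A → B' ⊆ B → R A C B → R A' C B'
  baseMono : ∀ A C B D : Set M, R A C (B ∪ D) → R A (C ∪ B) D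
  rightExt : ∀ A C B D : Set M, R A C B → B ⊆ D →
    ∃ σ : M ≃[L] M, FixesSet L M σ (B ∪ C) ∧ R A C ((fun x => σ x) '' D)
  leftTrans : ∀ A₁ A₂ C B : Set M, R A₁ C B → R A₂ (C ∪ A₁) (B ∪ A₁) → R (A₁ ∪ A₂) C B
  strongerInv : ∀ A C B : Set M, R A C B →
    ∃ p : GType L M A, GType.Extends L M p (fun x : A => (x : M)) (B ∪ C) ∧
      GType.LascarInv L M κ C p
  presIndisc : ∀ (β : Type u) (f : ℕ → β → M) (A C : Set M),
    IndiscSeq L M C f → R A C (⋃ i, Set.range (f i)) → IndiscSeq L M (A ∪ C) f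

/-- `R` has left extension over `A`. -/
def LeftExtOver (R : Set M → Set M → Set M → Prop) (A : Set M) : Prop :=
  ∀ B C D : Set M, R B A C → B ⊆ D →
    ∃ σ : M ≃[L] M, FixesSet L M σ (A ∪ B) ∧ R ((fun x => σ x) '' D) A C

/-- `A` is an extension base for `R`: `a ⫝_A A` for every tuple `a`. -/
def RExtBase (R : Set M → Set M → Set M → Prop) (A : Set M) : Prop :=
  ∀ (α : Type u) (a : α → M), R (Set.range a) A A

/-- `σ` and `a` have the same Lascar strong type over `A`. -/
def EqLstp (κ : Cardinal.{u}) {ε : Type*} (A : Set M) (a b : ε → M) : Prop :=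
  ∃ σ : M ≃[L] M, IsLascarStrong L M κ A σ ∧ ∀ i, σ (a i) = b i

/-- `φ(x, e)` quasi Lascar divides over `A`. -/
def QuasiLascarDivides (κ : Cardinal.{u}) {α ε : Type*} (A : Set M)
    (φ : L.Formula (α ⊕ ε)) (e : ε → M) : Prop :=
  ∃ (m : ℕ) (es : Fin m → ε → M), (∀ j, EqLstp L M κ A e (es j)) ∧
    ¬ ∃ x : α → M, ∀ j, φ.Realize (Sum.elim x (es j))

/-- An alternation chain of length `n` for `φ(x, y)`. -/
def AltChain {α β : Type*} (φ : L.Formula (α ⊕ β)) (n : ℕ) : Prop :=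
  ∃ (as : ℕ → α → M) (b : β → M), IndiscSeq L M (∅ : Set M) as ∧
    ∀ i : ℕ, i < n - 1 →
      (φ.Realize (Sum.elim (as i) b) ↔ ¬ φ.Realize (Sum.elim (as (i + 1)) b))

/-- `k` is the alternation number of `φ`. -/
def AltNumber {α β : Type*} (φ : L.Formula (α ⊕ β)) (k : ℕ) : Prop :=
  AltChain L M φ k ∧ ∀ n : ℕ, AltChain L M φ n → n ≤ k



section Core
variable {L} {M}

/-- fibre -/
def sec {α β : Type u} (E : Set (α ⊕ β → M)) (b : β → M) : Set (α → M) :=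
  {x | Sum.elim x b ∈ E}

/-- swap -/
def swp {α β : Type u} (E : Set (α ⊕ β → M)) : Set (β ⊕ α → M) :=
  (fun g : β ⊕ α → M => g ∘ Sum.swap) ⁻¹' E

theorem swp_elim {α β : Type u} (E : Set (α ⊕ β → M)) (x : α → M) (y : β → M) :
    Sum.elim y x ∈ swp E ↔ Sum.elim x y ∈ E := by
  have : (Sum.elim y x) ∘ Sum.swap = Sum.elim x y := by
    funext i; cases i <;> rfl
  simp [swp, this]

theorem def_swp {A : Set M} {α β : Type u} {E : Set (α ⊕ β → M)} (h : A.Definable L E) :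
    A.Definable L (swp E) := h.preimage_comp _

theorem def_sec {A : Set M} {α β : Type u} {E : Set (α ⊕ β → M)} (h : A.Definable L E)
    (b : β → M) (hb : ∀ i, b i ∈ A) : A.Definable L (sec E b) := by
  rw [Set.definable_iff_exists_formula_sum] at h ⊢
  obtain ⟨φ, rfl⟩ := h
  refine ⟨φ.relabel (fun z => match z with
    | Sum.inl c => Sum.inl c
    | Sum.inr (Sum.inl x) => Sum.inr x
    | Sum.inr (Sum.inr y) => Sum.inl ⟨b y, hb y⟩), ?_⟩
  ext v
  simp only [sec, Set.mem_ofPred_eq, Language.Formula.realize_relabel]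
  refine iff_of_eq (congrArg _ ?_)
  funext z
  rcases z with c | x | y <;> rfl

theorem def_sec' {A : Set M} {α β : Type u} {E : Set (α ⊕ β → M)} (h : A.Definable L E)
    (a : α → M) (ha : ∀ i, a i ∈ A) : A.Definable L {y : β → M | Sum.elim a y ∈ E} := by
  have := def_sec (def_swp h) a ha
  convert this using 1
  ext y
  simp [sec, swp_elim]

theorem unsec {A X : Set M} {γ : Type u} {F : Set (γ → M)} (h : (A ∪ X).Definable L F) :
    ∃ ψ : Set (γ ⊕ X → M), A.Definable L ψ ∧ F = sec ψ (fun x : X => (x : M)) := by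
  classical
  rw [Set.definable_iff_exists_formula_sum] at h
  obtain ⟨φ, rfl⟩ := h
  let g : ↥(A ∪ X) ⊕ γ → A ⊕ (γ ⊕ X) := fun z => match z with
    | Sum.inl c => if hc : (c : M) ∈ A then Sum.inl ⟨c, hc⟩
        else Sum.inr (Sum.inr ⟨c, c.2.resolve_left hc⟩)
    | Sum.inr x => Sum.inr (Sum.inl x)
  refine ⟨{v | (φ.relabel g).Realize (Sum.elim (↑) v)}, ?_, ?_⟩
  · rw [Set.definable_iff_exists_formula_sum]
    exact ⟨_, rfl⟩
  · ext v
    simp only [sec, Set.mem_ofPred_eq, Language.Formula.realize_relabel]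
    refine iff_of_eq (congrArg _ ?_)
    funext z
    rcases z with c | x
    · by_cases hc : (c : M) ∈ A <;> simp [g, hc]
    · rfl

theorem def_ex {A : Set M} {α β : Type u} [Finite α] {E : Set (α ⊕ β → M)}
    (h : A.Definable L E) : A.Definable L {y : β → M | (sec E y).Nonempty} := by
  have := (def_swp h).exists_of_finite
  convert this using 1
  ext y
  simp [sec, swp_elim, Set.Nonempty]

/-- joint consistency of finitely many instances is definable -/
theorem def_multi {A : Set M} {α β ι : Type u} [Finite α] [Finite ι] {E : Set (α ⊕ β → M)}
    (h : A.Definable L E) :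
    A.Definable L {w : ι × β → M | ∃ x : α → M, ∀ i, Sum.elim x (fun b => w (i, b)) ∈ E} := by
  let E' : Set (α ⊕ (ι × β) → M) :=
    ⋂ i : ι, (fun g : α ⊕ (ι × β) → M => g ∘ (Sum.map id (fun b => (i, b)))) ⁻¹' E
  have hE' : A.Definable L E' := Set.definable_iInter_of_finite (fun i => h.preimage_comp _)
  convert def_ex hE' using 1
  ext w
  simp only [Set.mem_ofPred_eq, Set.Nonempty, sec, E', Set.mem_iInter, Set.mem_preimage]
  refine exists_congr fun x => forall_congr' fun i => iff_of_eq (congrArg (· ∈ E) ?_)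
  funext z; cases z <;> rfl

theorem def_empt {A : Set M} {α β : Type u} [Finite α] {E : Set (α ⊕ β → M)} {F : Set (α → M)}
    (h : A.Definable L E) (hF : A.Definable L F) :
    A.Definable L {y : β → M | (F ∩ sec E y).Nonempty} := by
  have := def_ex (h.inter (hF.preimage_comp (Sum.inl : α → α ⊕ β)))
  convert this using 1
  ext y
  simp only [Set.mem_ofPred_eq, Set.Nonempty, sec, Set.mem_inter_iff, Set.mem_preimage]
  refine exists_congr fun x => ?_
  rw [and_comm, Sum.elim_comp_inl]

theorem aut_mem {A : Set M} {γ : Type u} {D : Set (γ → M)} (h : A.Definable L D)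
    (σ : M ≃[L] M) (hσ : FixesSet L M σ A) (v : γ → M) :
    (fun i => σ (v i)) ∈ D ↔ v ∈ D := by
  rw [Set.definable_iff_exists_formula_sum] at h
  obtain ⟨φ, rfl⟩ := h
  simp only [Set.mem_ofPred_eq]
  have := Language.StrongHomClass.realize_formula σ φ (v := Sum.elim (↑) v)
  rw [← this]
  refine iff_of_eq (congrArg _ ?_)
  funext z
  rcases z with c | x
  · exact (hσ c c.2).symm
  · rfl

theorem aut_sec {A : Set M} {α β : Type u} {E : Set (α ⊕ β → M)} (h : A.Definable L E)
    (σ : M ≃[L] M) (hσ : FixesSet L M σ A) (x : α → M) (b : β → M) :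
    (fun i => σ (x i)) ∈ sec E (fun i => σ (b i)) ↔ x ∈ sec E b := by
  have := aut_mem h σ hσ (Sum.elim x b)
  simp only [sec, Set.mem_ofPred_eq]
  rw [← this]
  refine iff_of_eq (congrArg (· ∈ E) ?_)
  funext z; cases z <;> rfl

theorem fixes_symm {A : Set M} (σ : M ≃[L] M) (hσ : FixesSet L M σ A) :
    FixesSet L M σ.symm A := fun a ha => by
  have := hσ a ha
  conv_lhs => rw [← this]
  simp

theorem aut_sec' {A : Set M} {α β : Type u} {E : Set (α ⊕ β → M)} (h : A.Definable L E)
    (σ : M ≃[L] M) (hσ : FixesSet L M σ A) (x : α → M) (b : β → M) :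
    x ∈ sec E (fun i => σ (b i)) ↔ (fun i => σ.symm (x i)) ∈ sec E b := by
  rw [← aut_sec h σ hσ (fun i => σ.symm (x i)) b]
  simp

/-- same type over `N` -/
def Eqv (L : FirstOrder.Language.{u, u}) {M : Type u} [L.Structure M] (N : Set M) {γ : Type u}
    (a b : γ → M) : Prop :=
  ∀ D : Set (γ → M), N.Definable L D → a ∈ D → b ∈ D

theorem Eqv.iff {N : Set M} {γ : Type u} {a b : γ → M} (h : Eqv L N a b) {D : Set (γ → M)}
    (hD : N.Definable L D) : a ∈ D ↔ b ∈ D :=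
  ⟨h D hD, fun hb => by_contra fun ha => h _ hD.compl ha hb⟩

theorem Eqv.symm {N : Set M} {γ : Type u} {a b : γ → M} (h : Eqv L N a b) : Eqv L N b a :=
  fun _ hD hb => (h.iff hD).2 hb

theorem Eqv.comp {N : Set M} {γ δ : Type u} {a b : γ → M} (h : Eqv L N a b) (f : δ → γ) :
    Eqv L N (a ∘ f) (b ∘ f) :=
  fun _ hD ha => h _ (hD.preimage_comp f) ha

theorem eqv_aut {N : Set M} {γ : Type u} (σ : M ≃[L] M) (hσ : FixesSet L M σ N) (a : γ → M) :
    Eqv L N a (fun i => σ (a i)) :=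
  fun _ hD ha => (aut_mem hD σ hσ a).2 ha

/-- first `l` members of `r` are `k`-inconsistent for `E` -/
def KI {α β : Type u} (E : Set (α ⊕ β → M)) (k l : ℕ) (r : ℕ → β → M) : Prop :=
  ∀ s : Finset ℕ, (∀ i ∈ s, i < l) → s.card = k → ¬ ∃ x : α → M, ∀ i ∈ s, x ∈ sec E (r i)

structure Ctx (L : FirstOrder.Language.{u, u}) {M : Type u} [L.Structure M] (N : Set M) :
    Prop where
  tv : ∀ (γ : Type u) [Finite γ] (D : Set (γ → M)), N.Definable L D → D.Nonempty →
    ∃ y ∈ D, ∀ i, y i ∈ N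
  sat : ∀ (γ : Type u) [Finite γ] (B : Set M), B.Finite → ∀ F : Set (Set (γ → M)),
    (∀ D ∈ F, (N ∪ B).Definable L D) → (∀ T ⊆ F, T.Finite → (⋂₀ T).Nonempty) → (⋂₀ F).Nonempty
  hom : ∀ (γ : Type u) [Finite γ] (a b : γ → M), Eqv L N a b →
    ∃ σ : M ≃[L] M, FixesSet L M σ N ∧ ∀ i, σ (a i) = b i
  ntp2 : ∀ (α β : Type u) [Finite α] [Finite β] (E : Set (α ⊕ β → M)), N.Definable L E →
    ∀ k : ℕ, ¬ ∀ m l : ℕ, ∃ a : ℕ → ℕ → β → M, (∀ j < m, KI E k l (a j)) ∧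
      ∀ f : ℕ → ℕ, (∀ j < m, f j < l) → ∃ x : α → M, ∀ j < m, x ∈ sec E (a j (f j))

/-- dividing over `N`, in terms of automorphisms -/
def Dv (L : FirstOrder.Language.{u, u}) {M : Type u} [L.Structure M] (N : Set M)
    {α β : Type u} (E : Set (α ⊕ β → M)) (a : β → M) (k : ℕ) : Prop :=
  ∃ r : ℕ → β → M, (∀ i, Eqv L N a (r i)) ∧ ∀ l, KI E k l r

/-- finite satisfiability in `N` -/
def FS (L : FirstOrder.Language.{u, u}) {M : Type u} [L.Structure M] (N X B : Set M) : Prop :=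
  ∀ (γ : Type u) [Finite γ] (x : γ → M), (∀ i, x i ∈ X) → ∀ D : Set (γ → M),
    (N ∪ B).Definable L D → x ∈ D → ∃ y ∈ D, ∀ i, y i ∈ N

/-- realizes the ultrafilter over `N ∪ B` -/
def Rz (L : FirstOrder.Language.{u, u}) {M : Type u} [L.Structure M] (N : Set M) {γ : Type u}
    (U : Ultrafilter (γ → M)) (B : Set M) (c : γ → M) : Prop :=
  ∀ D : Set (γ → M), (N ∪ B).Definable L D → D ∈ U → c ∈ D

def Coh (N : Set M) {γ : Type u} (U : Ultrafilter (γ → M)) : Prop :=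
  {n : γ → M | ∀ i, n i ∈ N} ∈ U

theorem Rz.iff {N B : Set M} {γ : Type u} {U : Ultrafilter (γ → M)} {c : γ → M}
    (h : Rz L N U B c) {D : Set (γ → M)} (hD : (N ∪ B).Definable L D) : c ∈ D ↔ D ∈ U :=
  ⟨fun hc => by_contra fun hn =>
    h _ hD.compl (Ultrafilter.compl_mem_iff_notMem.2 hn) hc, h D hD⟩

theorem Rz.mono {N B B' : Set M} {γ : Type u} {U : Ultrafilter (γ → M)} {c : γ → M}
    (h : Rz L N U B c) (hB : B' ⊆ B) : Rz L N U B' c :=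
  fun D hD hU => h D (hD.mono (Set.union_subset_union_right _ hB)) hU

theorem rz_exists {N : Set M} (C : Ctx L N) {γ : Type u} [Finite γ] (U : Ultrafilter (γ → M))
    {B : Set M} (hB : B.Finite) : ∃ c, Rz L N U B c := by
  obtain ⟨c, hc⟩ := C.sat γ B hB {D | (N ∪ B).Definable L D ∧ D ∈ U} (fun D hD => hD.1)
    (fun T hT hf => Ultrafilter.nonempty_of_mem
      ((Filter.sInter_mem hf).2 (fun D hD => (hT hD).2)) )
  exact ⟨c, fun D hD hU => hc D ⟨hD, hU⟩⟩

theorem Rz.fs {N B : Set M} {γ : Type u} {U : Ultrafilter (γ → M)} (hU : Coh N U) {c : γ → M}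
    (h : Rz L N U B c) : FS L N (Set.range c) B := by
  intro δ _ x hx D hD hxD
  choose f hf using hx
  have h1 : (fun g : γ → M => g ∘ f) ⁻¹' D ∈ U := by
    rw [← h.iff (hD.preimage_comp f)]
    have : c ∘ f = x := funext hf
    simpa [this] using hxD
  obtain ⟨n, hn1, hn2⟩ := Ultrafilter.nonempty_of_mem (Filter.inter_mem h1 hU)
  exact ⟨n ∘ f, hn1, fun i => hn2 (f i)⟩

theorem FS.mono {N X B B' : Set M} (h : FS L N X B) (hB : B' ⊆ B) : FS L N X B' :=
  fun γ _ x hx D hD hxD => h γ x hx D (hD.mono (Set.union_subset_union_right _ hB)) hxD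

theorem fs_empty {N B : Set M} : FS L N ∅ B :=
  fun _ _ x hx _ _ hxD => ⟨x, hxD, fun i => (hx i).elim⟩

theorem FS.trans {N X Y B : Set M} (h1 : FS L N X (B ∪ Y)) (h2 : FS L N Y B) :
    FS L N (X ∪ Y) B := by
  classical
  intro γ _ x hx D hD hxD
  let p : γ → Prop := fun i => x i ∈ X
  let e : {i // p i} ⊕ {i // ¬ p i} ≃ γ := Equiv.sumCompl p
  let D' : Set ({i // p i} ⊕ {i // ¬ p i} → M) := (fun g => g ∘ e.symm) ⁻¹' D
  have hD' : (N ∪ B).Definable L D' := hD.preimage_comp _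
  let x1 : {i // p i} → M := fun i => x i
  let x2 : {i // ¬ p i} → M := fun i => x i
  have hx12 : Sum.elim x1 x2 ∈ D' := by
    have : (Sum.elim x1 x2) ∘ e.symm = x := by
      funext i
      by_cases hi : p i <;> simp [e, hi, x1, x2]
    simpa [D', this] using hxD
  have hx2 : ∀ i, x2 i ∈ Y := fun i => (hx i).resolve_left i.2
  obtain ⟨n1, hn1, hn1N⟩ := h1 _ x1 (fun i => i.2) (sec D' x2)
    (def_sec (hD'.mono (by intro z hz; rcases hz with hz | hz <;> simp [hz])) x2
      (fun i => by simp [hx2 i])) hx12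
  obtain ⟨n2, hn2, hn2N⟩ := h2 _ x2 hx2 {y | Sum.elim n1 y ∈ D'}
    (def_sec' hD' n1 (fun i => Or.inl (hn1N i))) hn1
  refine ⟨Sum.elim n1 n2 ∘ e.symm, hn2, fun i => ?_⟩
  simp only [Function.comp]
  rcases e.symm i with j | j
  · exact hn1N j
  · exact hn2N j

/-- the filter of traces on `N` of the type of `b` over `N ∪ B` -/
def tpF (L : FirstOrder.Language.{u, u}) {M : Type u} [L.Structure M] (N B : Set M) {γ : Type u}
    (b : γ → M) : Filter (γ → M) where
  sets := {S | ∃ D : Set (γ → M), (N ∪ B).Definable L D ∧ b ∈ D ∧ ∀ y ∈ D, (∀ i, y i ∈ N) → y ∈ S}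
  univ_sets := ⟨Set.univ, Set.definable_univ, trivial, fun _ _ _ => trivial⟩
  sets_of_superset := by
    rintro S T ⟨D, h1, h2, h3⟩ hST
    exact ⟨D, h1, h2, fun y hy hN => hST (h3 y hy hN)⟩
  inter_sets := by
    rintro S T ⟨D, h1, h2, h3⟩ ⟨D', h1', h2', h3'⟩
    exact ⟨D ∩ D', h1.inter h1', ⟨h2, h2'⟩, fun y hy hN => ⟨h3 y hy.1 hN, h3' y hy.2 hN⟩⟩

theorem mem_tpF {N B : Set M} {γ : Type u} {b : γ → M} {S : Set (γ → M)} :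
    S ∈ tpF L N B b ↔ ∃ D : Set (γ → M), (N ∪ B).Definable L D ∧ b ∈ D ∧
      ∀ y ∈ D, (∀ i, y i ∈ N) → y ∈ S := Iff.rfl

theorem coh_of_le {N B : Set M} {γ : Type u} {b : γ → M} {U : Ultrafilter (γ → M)}
    (h : (U : Filter (γ → M)) ≤ tpF L N B b) : Coh N U :=
  h (mem_tpF.2 ⟨Set.univ, Set.definable_univ, trivial, fun _ _ h => h⟩)

theorem rz_of_le {N B : Set M} {γ : Type u} {b : γ → M} {U : Ultrafilter (γ → M)}
    (h : (U : Filter (γ → M)) ≤ tpF L N B b) : Rz L N U B b := by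
  intro D hD hU
  by_contra hb
  have : Dᶜ ∈ U := h (mem_tpF.2 ⟨Dᶜ, hD.compl, hb, fun _ h _ => h⟩)
  exact Ultrafilter.compl_mem_iff_notMem.1 this hU

theorem fs_ultra {N X B : Set M} [Finite X] (h : FS L N X B) :
    ∃ W : Ultrafilter (X → M), Coh N W ∧ Rz L N W B (fun x : X => (x : M)) := by
  have : (tpF L N B (fun x : X => (x : M))).NeBot := by
    rw [Filter.neBot_iff]
    intro hb
    have h0 : (∅ : Set (X → M)) ∈ tpF L N B (fun x : X => (x : M)) := by rw [hb]; trivial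
    obtain ⟨D, h1, h2, h3⟩ := mem_tpF.1 h0
    obtain ⟨y, hy, hyN⟩ := h X _ (fun i => i.2) D h1 h2
    exact h3 y hy hyN
  exact ⟨Ultrafilter.of _, coh_of_le (Ultrafilter.of_le _), rz_of_le (Ultrafilter.of_le _)⟩

theorem eqv_of_rz {N B : Set M} {γ : Type u} {a c : γ → M} {U : Ultrafilter (γ → M)}
    (h : (U : Filter (γ → M)) ≤ tpF L N ∅ a) (hc : Rz L N U B c) : Eqv L N a c := by
  intro D hD ha
  have hD0 : (N ∪ ∅).Definable L D := by simpa using hD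
  refine hc D (hD.mono Set.subset_union_left) ?_
  exact ((rz_of_le h).iff hD0).1 ha

theorem inv2 {N : Set M} {γ β : Type u} {W : Ultrafilter (γ → M)} (hW : Coh N W) {a c : β → M}
    (hac : Eqv L N a c) {b b' : γ → M} (hb : Rz L N W (Set.range a) b) {B : Set M}
    (hb' : Rz L N W B b') (hcB : Set.range c ⊆ B) :
    Eqv L N (Sum.elim b a) (Sum.elim b' c) := by
  intro D hD hm
  have hdef : ∀ (d : β → M) (B : Set M), Set.range d ⊆ B → (N ∪ B).Definable L (sec D d) :=
    fun d B hd => def_sec (hD.mono Set.subset_union_left) d (fun i => Or.inr (hd ⟨i, rfl⟩))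
  have h1 : sec D a ∈ W := (hb.iff (hdef a _ subset_rfl)).1 hm
  refine hb' (sec D c) (hdef c B hcB) ?_
  filter_upwards [h1, hW] with n hn hnN
  exact hac _ (def_sec' hD n hnN) hn

end Core

section Core
variable {L} {M}

theorem seq_exists {X : Type*} (supp : X → Set M) (hs : ∀ x, (supp x).Finite)
    (R : Set M → X → Prop) (h : ∀ B : Set M, B.Finite → ∃ x, R B x) :
    ∃ s : ℕ → X, ∀ j, R {z | ∃ i < j, z ∈ supp (s i)} (s j) := by
  classical
  choose g hg using h
  let t : ℕ → {B : Set M // B.Finite} := fun n => Nat.rec ⟨∅, Set.finite_empty⟩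
    (fun _ B => ⟨B.1 ∪ supp (g B.1 B.2), B.2.union (hs _)⟩) n
  refine ⟨fun j => g (t j).1 (t j).2, fun j => ?_⟩
  have : ∀ j, {z | ∃ i < j, z ∈ supp (g (t i).1 (t i).2)} = (t j).1 := by
    intro j
    induction j with
    | zero => ext z; simp [t]
    | succ j ih =>
      have : (t (j+1)).1 = (t j).1 ∪ supp (g (t j).1 (t j).2) := rfl
      rw [this]
      ext z
      have hz' := Set.ext_iff.1 ih z
      constructor
      · rintro ⟨i, hi, hz⟩
        rcases Nat.lt_succ_iff_lt_or_eq.1 hi with h | rfl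
        · exact Or.inl (hz'.1 ⟨i, h, hz⟩)
        · exact Or.inr hz
      · rintro (hz | hz)
        · obtain ⟨i, hi, hz⟩ := hz'.2 hz
          exact ⟨i, by omega, hz⟩
        · exact ⟨j, by omega, hz⟩
  rw [this]
  exact hg _ _

theorem def_fin {A : Set M} {α β V : Type u} [Finite α] {E : Set (α ⊕ β → M)}
    (h : A.Definable L E) (g : ℕ → β → V) (s : Finset ℕ) :
    A.Definable L {w : V → M | ∃ x : α → M, ∀ i ∈ s, x ∈ sec E (fun b => w (g i b))} := by
  have := (def_multi (ι := ULift.{u} s) h).preimage_comp (fun z : ULift.{u} s × β => g z.1.down z.2)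
  convert this using 1
  ext w
  simp only [Set.mem_ofPred_eq, Set.mem_preimage, sec]
  refine exists_congr fun x => ⟨fun hx i => hx _ i.down.2, fun hx i hi => hx ⟨⟨i, hi⟩⟩⟩

def PP {α β : Type u} (U : Ultrafilter (β → M)) (E : Set (α ⊕ β → M)) : ℕ → Set (α → M) → Prop
  | 0, F => F.Nonempty
  | m + 1, F => ∀ᶠ c in (U : Filter (β → M)), PP U E m (F ∩ sec E c)

/-- parameters appearing before stage `j` -/
def ini {β : Type u} (c : ℕ → β → M) (j : ℕ) : Set M := {z | ∃ i < j, z ∈ Set.range (c i)}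

theorem ini_finite {β : Type u} [Finite β] (c : ℕ → β → M) (j : ℕ) : (ini c j).Finite := by
  have : ini c j = ⋃ i ∈ Set.Iio j, Set.range (c i) := by
    ext z; simp [ini]
  rw [this]
  exact (Set.finite_Iio j).biUnion (fun i _ => Set.finite_range _)

theorem morley_exists {N : Set M} (C : Ctx L N) {β : Type u} [Finite β]
    (U : Ultrafilter (β → M)) : ∃ c : ℕ → β → M, ∀ j, Rz L N U (ini c j) (c j) :=
  seq_exists (fun c : β → M => Set.range c) (fun _ => Set.finite_range _)
    (fun B c => Rz L N U B c) (fun _ hB => rz_exists C U hB)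

theorem pp_iff {N : Set M} {α β : Type u} [Finite α] {U : Ultrafilter (β → M)} (hU : Coh N U)
    {E : Set (α ⊕ β → M)} (hE : N.Definable L E) (c : ℕ → β → M) (m : ℕ)
    (hc : ∀ j < m, Rz L N U (ini c j) (c j)) (F : Set (α → M)) (hF : N.Definable L F) :
    PP U E m F ↔ ∃ x ∈ F, ∀ j < m, x ∈ sec E (c j) := by
  induction m generalizing F with
  | zero => simp [PP, Set.Nonempty]
  | succ m ih =>
    have ih' := ih (fun j hj => hc j (by omega))
    let G : Set (α → M) := ⋂ j : Fin m, sec E (c j)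
    have hG : (N ∪ ini c m).Definable L G :=
      Set.definable_iInter_of_finite (fun j => def_sec (hE.mono Set.subset_union_left) _
        (fun b => Or.inr ⟨j, j.2, b, rfl⟩))
    have h1 : PP U E (m + 1) F ↔ {y | ((F ∩ G) ∩ sec E y).Nonempty} ∈ U := by
      change (∀ᶠ c in (U : Filter (β → M)), PP U E m (F ∩ sec E c)) ↔ _
      refine Filter.eventually_congr ?_
      filter_upwards [hU] with n hn
      rw [ih' _ (hF.inter (def_sec hE n hn))]
      simp only [Set.Nonempty, G, Set.mem_inter_iff, Set.mem_iInter]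
      exact exists_congr fun x => ⟨fun h => ⟨⟨h.1.1, fun j => h.2 j j.2⟩, h.1.2⟩,
        fun h => ⟨⟨h.1.1, h.2⟩, fun j hj => h.1.2 ⟨j, hj⟩⟩⟩
    rw [h1, ← (hc m (by omega)).iff (def_empt (hE.mono Set.subset_union_left)
      ((hF.mono Set.subset_union_left).inter hG))]
    simp only [Set.mem_ofPred_eq, Set.Nonempty, G, Set.mem_inter_iff, Set.mem_iInter]
    refine exists_congr fun x => ⟨fun h => ⟨h.1.1, fun j hj => ?_⟩, fun h => ⟨⟨h.1, fun j => h.2 j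
      (by omega)⟩, h.2 m (by omega)⟩⟩
    rcases Nat.lt_succ_iff_lt_or_eq.1 hj with hj | rfl
    · exact h.1.2 ⟨j, hj⟩
    · exact h.2

/-- every definable member of `U` contains long `k`-inconsistent sequences -/
def Good (L : FirstOrder.Language.{u, u}) {M : Type u} [L.Structure M] (N : Set M)
    {α β : Type u} (E : Set (α ⊕ β → M)) (k : ℕ) (U : Ultrafilter (β → M)) : Prop :=
  ∀ B : Set M, B.Finite → ∀ θ : Set (β → M), (N ∪ B).Definable L θ → θ ∈ U →
    ∀ l : ℕ, ∃ r : ℕ → β → M, (∀ i < l, r i ∈ θ) ∧ KI E k l r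

theorem row_exists {N : Set M} (C : Ctx L N) {α β : Type u} [Finite α] [Finite β]
    {E : Set (α ⊕ β → M)} (hE : N.Definable L E) {k : ℕ} {U : Ultrafilter (β → M)}
    (hG : Good L N E k U) (l : ℕ) (B : Set M) (hB : B.Finite) :
    ∃ r : ℕ → β → M, (∀ i < l, Rz L N U B (r i)) ∧ KI E k l r := by
  let V := ULift.{u} (Fin (l+1)) × β
  let g : ℕ → β → V := fun i b => (⟨Fin.ofNat (l+1) i⟩, b)
  let F1 : Set (Set (V → M)) := {D | ∃ i < l, ∃ θ : Set (β → M), (N ∪ B).Definable L θ ∧ θ ∈ U ∧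
    D = (fun w => w ∘ g i) ⁻¹' θ}
  let F2 : Set (Set (V → M)) := {D | ∃ s : Finset ℕ, (∀ i ∈ s, i < l) ∧ s.card = k ∧
    D = {w : V → M | ∃ x : α → M, ∀ i ∈ s, x ∈ sec E (fun b => w (g i b))}ᶜ}
  have key : ∀ T ⊆ F1 ∪ F2, T.Finite → ∃ θ : Set (β → M), (N ∪ B).Definable L θ ∧ θ ∈ U ∧
      ∀ w : V → M, (∀ i < l, w ∘ g i ∈ θ) → KI E k l (fun i => w ∘ g i) → ∀ D ∈ T, w ∈ D := by
    intro T hT hf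
    induction T, hf using Set.Finite.induction_on with
    | empty => exact ⟨Set.univ, Set.definable_univ, Filter.univ_mem, by simp⟩
    | @insert D T _ _ ih =>
      obtain ⟨θ, h1, h2, h3⟩ := ih (fun x hx => hT (Set.mem_insert_of_mem _ hx))
      rcases hT (Set.mem_insert D T) with ⟨i, hi, θ', h1', h2', rfl⟩ | ⟨s, hs, hk, rfl⟩
      · refine ⟨θ ∩ θ', h1.inter h1', Filter.inter_mem h2 h2', fun w hw hK D hD => ?_⟩
        rcases hD with rfl | hD
        · exact (hw i hi).2
        · exact h3 w (fun i hi => (hw i hi).1) hK D hD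
      · refine ⟨θ, h1, h2, fun w hw hK D hD => ?_⟩
        rcases hD with rfl | hD
        · exact hK s hs hk
        · exact h3 w hw hK D hD
  obtain ⟨w, hw⟩ := C.sat V B hB (F1 ∪ F2) (by
    rintro D (⟨i, hi, θ, h1, h2, rfl⟩ | ⟨s, hs, hk, rfl⟩)
    · exact h1.preimage_comp _
    · exact (def_fin (hE.mono Set.subset_union_left) g s).compl) (by
    intro T hT hf
    obtain ⟨θ, h1, h2, h3⟩ := key T hT hf
    obtain ⟨r, hr, hK⟩ := hG B hB θ h1 h2 l
    have e : ∀ i < l, (fun z : V => r z.1.down z.2) ∘ g i = r i := by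
      intro i hi
      funext b
      simp [g, Nat.mod_eq_of_lt (show i < l + 1 by omega)]
    refine ⟨fun z => r z.1.down z.2, h3 _ (fun i hi => ?_) ?_⟩
    · rw [e i hi]; exact hr i hi
    · rintro s hs hk ⟨x, hx⟩
      refine hK s hs hk ⟨x, fun i hi => ?_⟩
      have := hx i hi
      beta_reduce at this
      rwa [e i (hs i hi)] at this)
  refine ⟨fun i => w ∘ g i, fun i hi D hD hU => hw _ (Or.inl ⟨i, hi, D, hD, hU, rfl⟩), ?_⟩
  intro s hs hk
  exact hw _ (Or.inr ⟨s, hs, hk, rfl⟩)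

theorem good_pp {N : Set M} (C : Ctx L N) {α β : Type u} [Finite α] [Finite β]
    {E : Set (α ⊕ β → M)} (hE : N.Definable L E) {k : ℕ} {U : Ultrafilter (β → M)}
    (hU : Coh N U) (hG : Good L N E k U) : ∃ m, ¬ PP U E m Set.univ := by
  by_contra! hP
  refine C.ntp2 α β E hE k (fun m l => ?_)
  obtain ⟨a, ha⟩ := seq_exists (fun r : ℕ → β → M => ini r l) (fun r => ini_finite r l)
    (fun B r => (∀ i < l, Rz L N U B (r i)) ∧ KI E k l r)
    (fun B hB => row_exists C hE hG l B hB)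
  refine ⟨a, fun j _ => (ha j).2, fun f hf => ?_⟩
  have := (pp_iff hU hE (fun j => a j (f j)) m (fun j hj => by
    refine ((ha j).1 (f j) (hf j hj)).mono ?_
    rintro z ⟨i, hi, hz⟩
    exact ⟨i, hi, f i, hf i (by omega), hz⟩) Set.univ Set.definable_univ).1 (hP m)
  obtain ⟨x, _, hx⟩ := this
  exact ⟨x, hx⟩

end Core

section Core
variable {L} {M}

abbrev VV (l : ℕ) (β : Type u) : Type u := ULift.{u} (Fin (l+1)) × β

def gg {β : Type u} (l : ℕ) (i : ℕ) (b : β) : VV l β := (⟨Fin.ofNat (l+1) i⟩, b)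

def vec {β : Type u} (l : ℕ) (r : ℕ → β → M) (z : VV l β) : M := r z.1.down z.2

theorem vec_gg {β : Type u} {l : ℕ} (r : ℕ → β → M) {i : ℕ} (hi : i < l) :
    vec l r ∘ gg l i = r i := by
  funext b
  simp [vec, gg, Nat.mod_eq_of_lt (show i < l + 1 by omega)]

theorem KI.congr {α β : Type u} {E : Set (α ⊕ β → M)} {k l : ℕ} {r r' : ℕ → β → M}
    (h : KI E k l r) (hr : ∀ i < l, r' i = r i) : KI E k l r' := by
  rintro s hs hk ⟨x, hx⟩
  exact h s hs hk ⟨x, fun i hi => by rw [← hr i (hs i hi)]; exact hx i hi⟩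

theorem def_ki {A : Set M} {α β V : Type u} [Finite α] {E : Set (α ⊕ β → M)}
    (h : A.Definable L E) (g : ℕ → β → V) (k l : ℕ) :
    A.Definable L {w : V → M | KI E k l (fun i => w ∘ g i)} := by
  have : {w : V → M | KI E k l (fun i => w ∘ g i)} =
      ⋂ s : ↥((Finset.range l).powersetCard k),
        {w : V → M | ∃ x : α → M, ∀ i ∈ s.1, x ∈ sec E (fun b => w (g i b))}ᶜ := by
    ext w
    simp only [Set.mem_ofPred_eq, Set.mem_iInter, KI]
    constructor
    · intro hw s
      have := Finset.mem_powersetCard.1 s.2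
      exact hw s.1 (fun i hi => Finset.mem_range.1 (this.1 hi)) this.2
    · intro hw s hs hk
      exact hw ⟨s, Finset.mem_powersetCard.2 ⟨fun i hi => Finset.mem_range.2 (hs i hi), hk⟩⟩
  rw [this]
  exact Set.definable_iInter_of_finite (fun s => (def_fin h g s.1).compl)

theorem ki_sub {α β : Type u} {E : Set (α ⊕ β → M)} {k n : ℕ} {r : ℕ → β → M}
    (h : KI E k n r) (S : Finset ℕ) (hS : ∀ i ∈ S, i < n) (l : ℕ) (hl : l ≤ S.card) :
    ∃ f : ℕ → ℕ, (∀ i < l, f i ∈ S) ∧ KI E k l (fun i => r (f i)) := by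
  classical
  let f : ℕ → ℕ := fun i => if hi : i < l then (S.equivFin.symm ⟨i, by omega⟩ : ℕ) else 0
  have hf : ∀ i (hi : i < l), f i = (S.equivFin.symm ⟨i, by omega⟩ : ℕ) := fun i hi => by
    simp [f, hi]
  refine ⟨f, fun i hi => ?_, ?_⟩
  · rw [hf i hi]; exact (S.equivFin.symm ⟨i, by omega⟩).2
  · rintro s hs hk ⟨x, hx⟩
    have hm : ∀ i ∈ s, f i ∈ S := fun i hi => by
      rw [hf i (hs i hi)]; exact (S.equivFin.symm _).2
    refine h (s.image f) ?_ ?_ ⟨x, ?_⟩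
    · intro j hj
      obtain ⟨i, hi, rfl⟩ := Finset.mem_image.1 hj
      exact hS _ (hm i hi)
    · rw [Finset.card_image_of_injOn, hk]
      intro i hi j hj hij
      have hi' := hs i hi
      have hj' := hs j hj
      rw [hf i hi', hf j hj'] at hij
      have := S.equivFin.symm.injective (Subtype.ext hij)
      simpa using this
    · intro j hj
      obtain ⟨i, hi, rfl⟩ := Finset.mem_image.1 hj
      exact hx i hi

def Gd (L : FirstOrder.Language.{u, u}) {M : Type u} [L.Structure M] (N : Set M)
    {α β : Type u} (E : Set (α ⊕ β → M)) (a : β → M) (k : ℕ) (θ : Set (β → M)) : Prop :=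
  ∀ l : ℕ, ∀ D : Set (β → M), N.Definable L D → a ∈ D → ∃ r : ℕ → β → M,
    (∀ i < l, r i ∈ θ ∧ r i ∈ D ∧ ∀ b, r i b ∈ N) ∧ KI E k l r

theorem Gd.mono {N : Set M} {α β : Type u} {E : Set (α ⊕ β → M)} {a : β → M} {k : ℕ}
    {θ θ' : Set (β → M)} (h : Gd L N E a k θ) (hs : θ ⊆ θ') : Gd L N E a k θ' := by
  intro l D hD ha
  obtain ⟨r, h1, h2⟩ := h l D hD ha
  exact ⟨r, fun i hi => ⟨hs (h1 i hi).1, (h1 i hi).2⟩, h2⟩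

theorem Gd.part {N : Set M} {α β : Type u} {E : Set (α ⊕ β → M)} {a : β → M} {k : ℕ}
    {θ θ' : Set (β → M)} (h : Gd L N E a k (θ ∪ θ')) : Gd L N E a k θ ∨ Gd L N E a k θ' := by
  classical
  by_contra! hn
  obtain ⟨h1, h2⟩ := hn
  simp only [Gd, not_forall] at h1 h2
  obtain ⟨l1, D1, hD1, ha1, h1⟩ := h1
  obtain ⟨l2, D2, hD2, ha2, h2⟩ := h2
  obtain ⟨r, hr, hK⟩ := h (l1 + l2) (D1 ∩ D2) (hD1.inter hD2) ⟨ha1, ha2⟩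
  let S1 := (Finset.range (l1 + l2)).filter (fun i => r i ∈ θ)
  let S2 := (Finset.range (l1 + l2)).filter (fun i => r i ∉ θ)
  have hc : S1.card + S2.card = l1 + l2 := by
    simpa using Finset.card_filter_add_card_filter_not (s := Finset.range (l1+l2)) (fun i => r i ∈ θ)
  have e1 : ∀ i ∈ S1, i < l1 + l2 ∧ r i ∈ θ := fun i hi => by simpa [S1] using hi
  have e2 : ∀ i ∈ S2, i < l1 + l2 ∧ r i ∉ θ := fun i hi => by simpa [S2] using hi
  by_cases hl : l1 ≤ S1.card
  · obtain ⟨f, hf, hK'⟩ := ki_sub hK S1 (fun i hi => (e1 i hi).1) l1 hl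
    refine h1 ⟨_, fun i hi => ?_, hK'⟩
    have := e1 _ (hf i hi)
    have h' := hr _ this.1
    exact ⟨this.2, h'.2.1.1, h'.2.2⟩
  · obtain ⟨f, hf, hK'⟩ := ki_sub hK S2 (fun i hi => (e2 i hi).1) l2 (by omega)
    refine h2 ⟨_, fun i hi => ?_, hK'⟩
    have := e2 _ (hf i hi)
    have h' := hr _ this.1
    exact ⟨h'.1.resolve_left this.2, h'.2.1.2, h'.2.2⟩

theorem gd_univ {N : Set M} (C : Ctx L N) {α β : Type u} [Finite α] [Finite β]
    {E : Set (α ⊕ β → M)} (hE : N.Definable L E) {a : β → M} {k : ℕ} (h : Dv L N E a k) :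
    Gd L N E a k Set.univ := by
  intro l D hD ha
  obtain ⟨r, hr, hK⟩ := h
  let W : Set (VV l β → M) := {w | KI E k l (fun i => w ∘ gg l i)} ∩
    ⋂ i : Fin l, (fun w : VV l β → M => w ∘ gg l i) ⁻¹' D
  have hW : N.Definable L W := (def_ki hE _ k l).inter
    (Set.definable_iInter_of_finite (fun i => hD.preimage_comp _))
  obtain ⟨w, hw, hwN⟩ := C.tv _ W hW ⟨vec l r, by
    refine ⟨(hK l).congr (fun i hi => vec_gg r hi), Set.mem_iInter.2 fun i => ?_⟩
    change vec l r ∘ gg l i ∈ D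
    rw [vec_gg r i.2]
    exact hr i D hD ha⟩
  refine ⟨fun i => w ∘ gg l i, fun i hi => ⟨trivial, ?_, fun b => hwN _⟩, hw.1⟩
  exact Set.mem_iInter.1 hw.2 ⟨i, hi⟩

theorem lemmaA {N : Set M} (C : Ctx L N) {α β : Type u} [Finite α] [Finite β]
    {E : Set (α ⊕ β → M)} (hE : N.Definable L E) {a : β → M} {k : ℕ} (h : Dv L N E a k) :
    ∃ U : Ultrafilter (β → M), (U : Filter (β → M)) ≤ tpF L N ∅ a ∧
      ∃ m, ¬ PP U E m Set.univ := by
  let F : Filter (β → M) :=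
    { sets := {S | ¬ Gd L N E a k Sᶜ}
      univ_sets := by
        intro hg
        obtain ⟨r, hr, _⟩ := hg 1 Set.univ Set.definable_univ trivial
        exact (hr 0 (by omega)).1 trivial
      sets_of_superset := fun {S T} hS hST hT => hS (hT.mono (Set.compl_subset_compl.2 hST))
      inter_sets := fun {S T} hS hT hI => by
        rw [Set.compl_inter] at hI
        exact hI.part.elim hS hT }
  have hF : ∀ S, S ∈ F ↔ ¬ Gd L N E a k Sᶜ := fun S => Iff.rfl
  have : F.NeBot := by
    rw [Filter.neBot_iff]
    intro hb
    have : (∅ : Set (β → M)) ∈ F := by rw [hb]; trivial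
    rw [hF, Set.compl_empty] at this
    exact this (gd_univ C hE h)
  have hle := Ultrafilter.of_le F
  have hle' : (Ultrafilter.of F : Filter (β → M)) ≤ tpF L N ∅ a := by
    refine hle.trans ?_
    intro S hS
    obtain ⟨D, h1, h2, h3⟩ := mem_tpF.1 hS
    rw [hF]
    intro hg
    obtain ⟨r, hr, _⟩ := hg 1 D (by simpa using h1) h2
    have := hr 0 (by omega)
    exact this.1 (h3 _ this.2.1 this.2.2)
  refine ⟨Ultrafilter.of F, hle', good_pp C hE (coh_of_le hle') (k := k) ?_⟩
  intro B hB θ hθ hU l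
  have : Gd L N E a k θ := by
    by_contra hn
    have : θᶜ ∈ F := by rw [hF, compl_compl]; exact hn
    exact Ultrafilter.compl_mem_iff_notMem.1 (hle this) hU
  obtain ⟨r, hr, hK⟩ := this l Set.univ Set.definable_univ trivial
  exact ⟨r, fun i hi => (hr i hi).1, hK⟩

end Core

section Core
variable {L} {M}

theorem Eqv.trans {N : Set M} {γ : Type u} {a b c : γ → M} (h : Eqv L N a b) (h' : Eqv L N b c) :
    Eqv L N a c := fun D hD ha => h' D hD (h D hD ha)

theorem Eqv.refl {N : Set M} {γ : Type u} (a : γ → M) : Eqv L N a a := fun _ _ ha => ha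

theorem Dv.eqv {N : Set M} {α β : Type u} {E : Set (α ⊕ β → M)} {a c : β → M} {k : ℕ}
    (h : Dv L N E a k) (hac : Eqv L N a c) : Dv L N E c k := by
  obtain ⟨r, hr, hK⟩ := h
  exact ⟨r, fun i => hac.symm.trans (hr i), hK⟩

def InvF (L : FirstOrder.Language.{u, u}) {M : Type u} [L.Structure M] (N : Set M) {α : Type u}
    (V : Filter (α → M)) : Prop :=
  ∀ (β : Type u) [Finite β] (D : Set (α ⊕ β → M)), N.Definable L D → ∀ b b' : β → M,
    Eqv L N b b' → sec D b ∈ V → sec D b' ∈ V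

def Ign (L : FirstOrder.Language.{u, u}) {M : Type u} [L.Structure M] (N : Set M) {α β : Type u}
    (V : Filter (α → M)) (D : Set (α ⊕ β → M)) (a : β → M) : Prop :=
  ∀ c, Eqv L N a c → ∀ X : Set M, X.Finite → ∀ F : Set (α → M), (N ∪ X).Definable L F →
    FS L N X (Set.range c) → F ∪ sec D c ∈ V → F ∈ V

def rest {β γ : Type u} (b : γ → M) (c : ℕ → β → M) (m l : ℕ) : Set M :=
  Set.range b ∪ {z | ∃ j, l ≤ j ∧ j < m ∧ z ∈ Set.range (c j)}

theorem rest_finite {β γ : Type u} [Finite β] [Finite γ] (b : γ → M) (c : ℕ → β → M) (m l : ℕ) :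
    (rest b c m l).Finite := by
  refine (Set.finite_range b).union ((ini_finite c m).subset ?_)
  rintro z ⟨j, _, h, hz⟩
  exact ⟨j, h, hz⟩

theorem fs_rest {N : Set M} {β γ : Type u} {U : Ultrafilter (β → M)} (hU : Coh N U)
    {W : Ultrafilter (γ → M)} (hW : Coh N W) (c : ℕ → β → M)
    (hc : ∀ j, Rz L N U (ini c j) (c j)) (b : γ → M) (m : ℕ) (hb : Rz L N W (ini c m) b)
    (d l : ℕ) (hl : l + d = m) : FS L N (rest b c m l) (ini c l) := by
  induction d generalizing l with
  | zero =>
    obtain rfl : l = m := by omega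
    have : rest b c l l = Set.range b := by
      ext z
      simp only [rest, Set.mem_union, Set.mem_ofPred_eq]
      refine ⟨fun h => h.elim id ?_, Or.inl⟩
      rintro ⟨j, h1, h2, _⟩
      omega
    rw [this]
    exact hb.fs hW
  | succ d ih =>
    have h1 := ih (l + 1) (by omega)
    have e1 : ini c (l + 1) = ini c l ∪ Set.range (c l) := by
      ext z
      constructor
      · rintro ⟨i, hi, hz⟩
        rcases Nat.lt_succ_iff_lt_or_eq.1 hi with h | rfl
        · exact Or.inl ⟨i, h, hz⟩
        · exact Or.inr hz
      · rintro (⟨i, hi, hz⟩ | hz)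
        · exact ⟨i, by omega, hz⟩
        · exact ⟨l, by omega, hz⟩
    have e2 : rest b c m l = rest b c m (l + 1) ∪ Set.range (c l) := by
      ext z
      constructor
      · rintro (hz | ⟨j, h1, h2, hz⟩)
        · exact Or.inl (Or.inl hz)
        · by_cases hj : j = l
          · subst hj; exact Or.inr hz
          · exact Or.inl (Or.inr ⟨j, by omega, h2, hz⟩)
      · rintro ((hz | ⟨j, h1, h2, hz⟩) | hz)
        · exact Or.inl hz
        · exact Or.inr ⟨j, by omega, h2, hz⟩
        · exact Or.inr ⟨l, by omega, by omega, hz⟩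
    rw [e1] at h1
    rw [e2]
    exact h1.trans ((hc l).fs hU)

theorem ign_step {N : Set M} (C : Ctx L N) {α β : Type u} [Finite α] [Finite β]
    {V : Filter (α → M)} (hV : InvF L N V) {D E : Set (α ⊕ β → M)} (hD : N.Definable L D)
    (hE : N.Definable L E) {a₀ : β → M} {k : ℕ} (hI : Ign L N V D a₀) (hd : Dv L N E a₀ k) :
    Ign L N V (D ∪ E) a₀ := by
  intro a haa X hX F hF hFS hmem
  have hda := hd.eqv haa
  obtain ⟨ψ, hψ, rfl⟩ := unsec hF
  have : Finite X := hX
  obtain ⟨W, hW, hWr⟩ := fs_ultra hFS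
  obtain ⟨U, hUa, m, hm⟩ := lemmaA C hE hda
  have hU := coh_of_le hUa
  obtain ⟨c, hc⟩ := morley_exists C U
  obtain ⟨b', hb'⟩ := rz_exists C W (ini_finite c m)
  have hac : ∀ j, Eqv L N a (c j) := fun j => eqv_of_rz hUa (hc j)
  have hee : ∀ j < m, Eqv L N (Sum.elim (fun x : X => (x : M)) a) (Sum.elim b' (c j)) :=
    fun j hj => inv2 hW (hac j) hWr hb' (by rintro z hz; exact ⟨j, hj, hz⟩)
  let H : Set (α ⊕ (X ⊕ β) → M) :=
    (fun g => g ∘ Sum.map id Sum.inl) ⁻¹' ψ ∪ (fun g => g ∘ Sum.map id Sum.inr) ⁻¹' (D ∪ E)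
  have hH : N.Definable L H := (hψ.preimage_comp _).union ((hD.union hE).preimage_comp _)
  have eH : ∀ (b : X → M) (c : β → M), sec H (Sum.elim b c) = sec ψ b ∪ sec (D ∪ E) c := by
    intro b c
    ext x
    simp only [sec, H, Set.mem_union, Set.mem_ofPred_eq, Set.mem_preimage]
    have h1 : Sum.elim x (Sum.elim b c) ∘ Sum.map id Sum.inl = Sum.elim x b := by
      funext i; cases i <;> rfl
    have h2 : Sum.elim x (Sum.elim b c) ∘ Sum.map id Sum.inr = Sum.elim x c := by
      funext i; cases i <;> rfl
    rw [h1, h2]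
  have hj : ∀ j < m, sec ψ b' ∪ sec (D ∪ E) (c j) ∈ V := by
    intro j hj
    rw [← eH]
    exact hV _ H hH _ _ (hee j hj) (by rw [eH]; exact hmem)
  let R : ℕ → Set (α → M) := fun l => sec ψ b' ∪ {x | ∃ j, l ≤ j ∧ j < m ∧ x ∈ sec D (c j)}
  have hR : ∀ l ≤ m, R l ∈ V := by
    intro l
    induction l with
    | zero =>
      intro _
      have h1 : (⋂ j ∈ Finset.range m, (sec ψ b' ∪ sec (D ∪ E) (c j))) ∈ V :=
        (Filter.biInter_finset_mem _).2 (fun j hjj => hj j (Finset.mem_range.1 hjj))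
      filter_upwards [h1] with x hx
      simp only [Set.mem_iInter, Finset.mem_range] at hx
      by_contra hn
      refine hm ((pp_iff hU hE c m (fun j _ => hc j) Set.univ Set.definable_univ).2
        ⟨x, trivial, fun j hjm => ?_⟩)
      rcases hx j hjm with h | h | h
      · exact (hn (Or.inl h)).elim
      · exact (hn (Or.inr ⟨j, by omega, hjm, h⟩)).elim
      · exact h
    | succ l ih =>
      intro hl
      have h0 := ih (by omega)
      have hfs := fs_rest hU hW c hc b' m hb' (m - (l+1)) (l+1) (by omega)
      refine hI (c l) (haa.trans (hac l)) (rest b' c m (l+1)) (rest_finite _ _ _ _) (R (l+1)) ?_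
        (hfs.mono (by rintro z hz; exact ⟨l, by omega, hz⟩)) ?_
      · have e : R (l+1) = sec ψ b' ∪ ⋃ j : {j : Fin m // l + 1 ≤ j.1}, sec D (c j.1) := by
          ext x
          simp only [R, Set.mem_union, Set.mem_ofPred_eq, Set.mem_iUnion]
          refine or_congr Iff.rfl ⟨?_, ?_⟩
          · rintro ⟨j, h1, h2, hx⟩; exact ⟨⟨⟨j, h2⟩, h1⟩, hx⟩
          · rintro ⟨j, hx⟩; exact ⟨j.1, j.2, j.1.2, hx⟩
        rw [e]
        refine (def_sec (hψ.mono Set.subset_union_left) _ (fun i => Or.inr (Or.inl ⟨i, rfl⟩))).union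
          (Set.definable_iUnion_of_finite fun j =>
            def_sec (hD.mono Set.subset_union_left) _ (fun i => Or.inr (Or.inr ?_)))
        exact ⟨j.1, j.2, j.1.2, i, rfl⟩
      · filter_upwards [h0] with x hx
        rcases hx with hx | ⟨j, h1, h2, hx⟩
        · exact Or.inl (Or.inl hx)
        · by_cases hjl : j = l
          · subst hjl; exact Or.inr hx
          · exact Or.inl (Or.inr ⟨j, by omega, h2, hx⟩)
  have hfin : sec ψ b' ∈ V := by
    filter_upwards [hR m le_rfl] with x hx
    rcases hx with hx | ⟨j, h1, h2, hx⟩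
    · exact hx
    · omega
  have hb'' : Eqv L N (fun x : X => (x : M)) b' := fun D hD hm' =>
    hb' D (hD.mono Set.subset_union_left) ((hWr.iff (hD.mono Set.subset_union_left)).1 hm')
  exact hV _ ψ hψ _ _ hb''.symm hfin

theorem ign_list {N : Set M} (C : Ctx L N) {α β : Type u} [Finite α] [Finite β]
    {V : Filter (α → M)} (hV : InvF L N V) {a : β → M} (n : ℕ) (E : Fin n → Set (α ⊕ β → M))
    (hE : ∀ i, N.Definable L (E i)) (hd : ∀ i, ∃ k, Dv L N (E i) a k) :
    Ign L N V (⋃ i, E i) a := by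
  induction n with
  | zero =>
    intro c _ X _ F _ _ hm
    have : F ∪ sec (⋃ i, E i) c = F := by
      ext x; simp [sec]
    rwa [this] at hm
  | succ n ih =>
    have h1 := ih (fun i => E i.castSucc) (fun i => hE _) (fun i => hd _)
    obtain ⟨k, hk⟩ := hd (Fin.last n)
    have h2 := ign_step C hV (Set.definable_iUnion_of_finite fun i => hE _) (hE (Fin.last n)) h1 hk
    have : (⋃ i, E i) = (⋃ i : Fin n, E i.castSucc) ∪ E (Fin.last n) := by
      ext g
      simp only [Set.mem_iUnion, Set.mem_union]
      exact Fin.exists_fin_succ'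
    rw [this]
    exact h2

theorem qd {N : Set M} (C : Ctx L N) {α β : Type u} [Finite α] [Finite β]
    {a : β → M} {G : Set (α ⊕ β → M)} (hG : N.Definable L G) (n : ℕ)
    (E : Fin n → Set (α ⊕ β → M))
    (hE : ∀ i, N.Definable L (E i)) (hd : ∀ i, ∃ k, Dv L N (E i) a k)
    (hsub : ∀ x ∈ sec G a, ∃ i, x ∈ sec (E i) a) :
    ∃ (m : ℕ) (c : Fin m → β → M), (∀ j, Eqv L N a (c j)) ∧ ¬ ∃ x, ∀ j, x ∈ sec G (c j) := by
  let gs : Set (Set (α → M)) := {S | ∃ c, Eqv L N a c ∧ S = sec G c}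
  let V : Filter (α → M) := Filter.generate gs
  have hV : InvF L N V := by
    intro γ _ D hD b b' hbb hmem
    obtain ⟨σ, hσ, hσb⟩ := C.hom γ b b' hbb
    have hmap : Filter.map (fun x : α → M => fun i => σ.symm (x i)) V ≤ V := by
      refine Filter.le_generate_iff.2 ?_
      rintro S ⟨c, hc, rfl⟩
      change _ ∈ V
      have : (fun x : α → M => fun i => σ.symm (x i)) ⁻¹' sec G c = sec G (fun i => σ (c i)) := by
        ext x
        exact (aut_sec' hG σ hσ x c).symm
      rw [this]
      exact Filter.mem_generate_of_mem ⟨_, hc.trans (eqv_aut σ hσ c), rfl⟩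
    have h1 := hmap hmem
    rw [Filter.mem_map] at h1
    have : (fun x : α → M => fun i => σ.symm (x i)) ⁻¹' sec D b = sec D b' := by
      ext x
      rw [Set.mem_preimage, ← aut_sec' hD σ hσ x b]
      have : (fun i => σ (b i)) = b' := funext hσb
      rw [this]
    rwa [this] at h1
  have hI := ign_list C hV n E hE hd
  have h0 : (∅ : Set (α → M)) ∈ V := by
    refine hI a (Eqv.refl a) ∅ Set.finite_empty ∅ Set.definable_empty fs_empty ?_
    have : sec G a ∈ V := Filter.mem_generate_of_mem ⟨a, Eqv.refl a, rfl⟩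
    filter_upwards [this] with x hx
    obtain ⟨i, hi⟩ := hsub x hx
    exact Or.inr (Set.mem_iUnion.2 ⟨i, hi⟩)
  obtain ⟨t, ht, htf, hts⟩ := Filter.mem_generate_iff.1 h0
  have : Finite t := htf
  choose c hc using fun S : t => ht S.2
  obtain ⟨m, ⟨e⟩⟩ := Finite.exists_equiv_fin t
  refine ⟨m, fun j => c (e.symm j), fun j => (hc _).1, ?_⟩
  rintro ⟨x, hx⟩
  refine hts (a := x) (Set.mem_sInter.2 fun S hS => ?_)
  have := hx (e ⟨S, hS⟩)
  beta_reduce at this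
  rw [Equiv.symm_apply_apply, ← (hc ⟨S, hS⟩).2] at this
  exact this

end Core

section Core
variable {L} {M}

/-- covering by dividing sets -/
def Fk (L : FirstOrder.Language.{u, u}) {M : Type u} [L.Structure M] (N : Set M) {γ β : Type u}
    (ψ : Set (γ ⊕ β → M)) (a : β → M) : Prop :=
  ∃ (ι : Type) (_ : Finite ι) (E : ι → Set (γ ⊕ β → M)), (∀ i, N.Definable L (E i)) ∧
    (∀ i, ∃ k, Dv L N (E i) a k) ∧ ∀ x ∈ sec ψ a, ∃ i, x ∈ sec (E i) a

theorem qd' {N : Set M} (C : Ctx L N) {α β : Type u} [Finite α] [Finite β]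
    {a : β → M} {G : Set (α ⊕ β → M)} (hG : N.Definable L G) (h : Fk L N G a) :
    ∃ (m : ℕ) (c : ℕ → β → M), (∀ j, Eqv L N a (c j)) ∧ ¬ ∃ x, ∀ j < m, x ∈ sec G (c j) := by
  obtain ⟨ι, _, E, h1, h2, h3⟩ := h
  obtain ⟨n, ⟨e⟩⟩ := Finite.exists_equiv_fin ι
  obtain ⟨m, c, hc, hn⟩ := qd C hG n (fun i => E (e.symm i)) (fun i => h1 _) (fun i => h2 _)
    (fun x hx => by
      obtain ⟨i, hi⟩ := h3 x hx
      exact ⟨e i, by simpa using hi⟩)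
  refine ⟨m, fun j => if hj : j < m then c ⟨j, hj⟩ else a, fun j => ?_, ?_⟩
  · by_cases hj : j < m
    · simp only [hj, dite_true]; exact hc _
    · simp only [hj, dite_false]; exact Eqv.refl a
  · rintro ⟨x, hx⟩
    refine hn ⟨x, fun j => ?_⟩
    have := hx j j.2
    simpa using this

theorem sec_lift {α β γ : Type u} (f : γ → α) (E : Set (γ ⊕ β → M)) (y : α → M) (b : β → M) :
    y ∈ sec ((fun g : α ⊕ β → M => g ∘ Sum.map f id) ⁻¹' E) b ↔ y ∘ f ∈ sec E b := by
  simp only [sec, Set.mem_ofPred_eq, Set.mem_preimage]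
  refine iff_of_eq (congrArg (· ∈ E) ?_)
  funext z; cases z <;> rfl

theorem dv_lift {N : Set M} {α β γ : Type u} (f : γ → α) {E : Set (γ ⊕ β → M)} {a : β → M} {k : ℕ}
    (h : Dv L N E a k) : Dv L N ((fun g : α ⊕ β → M => g ∘ Sum.map f id) ⁻¹' E) a k := by
  obtain ⟨r, hr, hK⟩ := h
  refine ⟨r, hr, fun l s hs hk => ?_⟩
  rintro ⟨x, hx⟩
  exact hK l s hs hk ⟨x ∘ f, fun i hi => (sec_lift f E x (r i)).1 (hx i hi)⟩

theorem strict_exists {N : Set M} (C : Ctx L N) {β : Type u} [Finite β] (a : β → M) :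
    ∃ U : Ultrafilter (β → M), (U : Filter (β → M)) ≤ tpF L N ∅ a ∧
      ∀ (γ : Type u) [Finite γ] (ψ : Set (γ ⊕ β → M)), N.Definable L ψ → ∀ b : γ → M,
        {n | Sum.elim b n ∈ ψ} ∈ U → ∀ k, ¬ Dv L N ψ a k := by
  let F : Filter (β → M) :=
    { sets := {S | ∃ (D : Set (β → M)) (γ : Type u) (_ : Finite γ) (ψ : Set (γ ⊕ β → M))
        (b : γ → M), N.Definable L D ∧ a ∈ D ∧ N.Definable L ψ ∧ Fk L N ψ a ∧
        ∀ n ∈ D, (∀ i, n i ∈ N) → Sum.elim b n ∉ ψ → n ∈ S}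
      univ_sets := ⟨Set.univ, PEmpty, inferInstance, ∅, fun i => i.elim, Set.definable_univ, trivial,
        Set.definable_empty, ⟨Fin 0, inferInstance, fun _ => ∅, fun i => i.elim0, fun i => i.elim0,
          fun x hx => hx.elim⟩, fun _ _ _ _ => trivial⟩
      sets_of_superset := by
        rintro S T ⟨D, γ, i, ψ, b, h1, h2, h3, h4, h5⟩ hST
        exact ⟨D, γ, i, ψ, b, h1, h2, h3, h4, fun n hn hN hb => hST (h5 n hn hN hb)⟩
      inter_sets := by
        rintro S T ⟨D, γ, _, ψ, b, h1, h2, h3, ⟨ι, _, E, e1, e2, e3⟩, h5⟩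
          ⟨D', γ', _, ψ', b', h1', h2', h3', ⟨ι', _, E', e1', e2', e3'⟩, h5'⟩
        let l1 : Set (γ ⊕ β → M) → Set ((γ ⊕ γ') ⊕ β → M) := fun X =>
          (fun g => g ∘ Sum.map Sum.inl id) ⁻¹' X
        let l2 : Set (γ' ⊕ β → M) → Set ((γ ⊕ γ') ⊕ β → M) := fun X =>
          (fun g => g ∘ Sum.map Sum.inr id) ⁻¹' X
        refine ⟨D ∩ D', γ ⊕ γ', inferInstance, l1 ψ ∪ l2 ψ', Sum.elim b b', h1.inter h1', ⟨h2, h2'⟩,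
          (h3.preimage_comp _).union (h3'.preimage_comp _), ⟨ι ⊕ ι', inferInstance,
          Sum.elim (fun i => l1 (E i)) (fun i => l2 (E' i)), ?_, ?_, ?_⟩, ?_⟩
        · rintro (i | i)
          · exact (e1 i).preimage_comp _
          · exact (e1' i).preimage_comp _
        · rintro (i | i)
          · obtain ⟨k, hk⟩ := e2 i
            exact ⟨k, dv_lift Sum.inl hk⟩
          · obtain ⟨k, hk⟩ := e2' i
            exact ⟨k, dv_lift Sum.inr hk⟩
        · rintro x (hx | hx)
          · obtain ⟨i, hi⟩ := e3 _ ((sec_lift Sum.inl ψ x a).1 hx)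
            exact ⟨Sum.inl i, (sec_lift Sum.inl (E i) x a).2 hi⟩
          · obtain ⟨i, hi⟩ := e3' _ ((sec_lift Sum.inr ψ' x a).1 hx)
            exact ⟨Sum.inr i, (sec_lift Sum.inr (E' i) x a).2 hi⟩
        · intro n hn hN hb
          refine ⟨h5 n hn.1 hN fun hh => hb (Or.inl ?_), h5' n hn.2 hN fun hh => hb (Or.inr ?_)⟩
          · exact (sec_lift Sum.inl ψ (Sum.elim b b') n).2 hh
          · exact (sec_lift Sum.inr ψ' (Sum.elim b b') n).2 hh }
  have hF : ∀ S, S ∈ F ↔ ∃ (D : Set (β → M)) (γ : Type u) (_ : Finite γ) (ψ : Set (γ ⊕ β → M))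
        (b : γ → M), N.Definable L D ∧ a ∈ D ∧ N.Definable L ψ ∧ Fk L N ψ a ∧
        ∀ n ∈ D, (∀ i, n i ∈ N) → Sum.elim b n ∉ ψ → n ∈ S := fun S => Iff.rfl
  have : F.NeBot := by
    rw [Filter.neBot_iff]
    intro hb
    have : (∅ : Set (β → M)) ∈ F := by rw [hb]; trivial
    obtain ⟨D, γ, _, ψ, b, h1, h2, h3, h4, h5⟩ := (hF _).1 this
    obtain ⟨m, c, hc, hn⟩ := qd' C h3 h4
    let W : Set (VV m β → M) := {w | ∃ x : γ → M, ∀ i ∈ Finset.range m,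
        x ∈ sec ψ (fun b => w (gg m i b))}ᶜ ∩
      ⋂ i : Fin m, (fun w : VV m β → M => w ∘ gg m i) ⁻¹' D
    have hW : N.Definable L W := (def_fin h3 (gg m) _).compl.inter
      (Set.definable_iInter_of_finite (fun i => h1.preimage_comp _))
    obtain ⟨w, hw, hwN⟩ := C.tv _ W hW ⟨vec m c, by
      refine ⟨?_, Set.mem_iInter.2 fun i => ?_⟩
      · rintro ⟨x, hx⟩
        refine hn ⟨x, fun j hj => ?_⟩
        have := hx j (Finset.mem_range.2 hj)
        rw [← vec_gg c hj]
        exact this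
      · change vec m c ∘ gg m i ∈ D
        rw [vec_gg c i.2]
        exact hc i D h1 h2⟩
    refine hw.1 ⟨b, fun i hi => ?_⟩
    by_contra hbad
    exact h5 (w ∘ gg m i) (Set.mem_iInter.1 hw.2 ⟨i, Finset.mem_range.1 hi⟩) (fun _ => hwN _) hbad
  have hle := Ultrafilter.of_le F
  refine ⟨Ultrafilter.of F, hle.trans ?_, ?_⟩
  · intro S hS
    obtain ⟨D, h1, h2, h3⟩ := mem_tpF.1 hS
    exact (hF _).2 ⟨D, PEmpty, inferInstance, ∅, fun i => i.elim, by simpa using h1, h2,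
        Set.definable_empty, ⟨Fin 0, inferInstance, fun _ => ∅, fun i => i.elim0, fun i => i.elim0,
          fun x hx => hx.elim⟩, fun n hn hN _ => h3 n hn hN⟩
  · intro γ _ ψ hψ b hU k hk
    have : {n | Sum.elim b n ∈ ψ}ᶜ ∈ F := (hF _).2 ⟨Set.univ, γ, inferInstance, ψ, b,
      Set.definable_univ, trivial, hψ, ⟨Unit, inferInstance, fun _ => ψ, fun _ => hψ,
        fun _ => ⟨k, hk⟩, fun x hx => ⟨(), hx⟩⟩, fun n _ _ h => h⟩
    exact Ultrafilter.compl_mem_iff_notMem.1 (hle this) hU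

theorem kim {N : Set M} {α β : Type u} [Finite α] [Finite β]
    {E : Set (α ⊕ β → M)} (hE : N.Definable L E) {a : β → M} {k : ℕ} (h : Dv L N E a k)
    {U : Ultrafilter (β → M)}
    (hU : ∀ (γ : Type u) [Finite γ] (ψ : Set (γ ⊕ β → M)), N.Definable L ψ → ∀ b : γ → M,
        {n | Sum.elim b n ∈ ψ} ∈ U → ∀ k, ¬ Dv L N ψ a k) : Good L N E k U := by
  obtain ⟨r, hr, hK⟩ := h
  intro B hB θ hθ hθU l
  obtain ⟨ψ0, hψ0, rfl⟩ := unsec hθ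
  have : Finite B := hB
  rcases Nat.eq_zero_or_pos l with rfl | hl
  · exact ⟨r, fun i hi => by omega, hK 0⟩
  let ψ := swp ψ0
  have hψ : N.Definable L ψ := def_swp hψ0
  let Z0 : Set (VV l β ⊕ B → M) := {g | KI E k l (fun i => g ∘ (Sum.inl ∘ gg l i))} ∩
    ⋂ i : Fin l, (fun g : VV l β ⊕ B → M => g ∘ Sum.elim Sum.inr (Sum.inl ∘ gg l i)) ⁻¹' ψ
  have hZ0 : N.Definable L Z0 := (def_ki hE (fun i => Sum.inl ∘ gg l i) k l).inter
    (Set.definable_iInter_of_finite fun i => hψ.preimage_comp _)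
  let Z : Set (B → M) := {y | (sec Z0 y).Nonempty}
  have hZ : N.Definable L Z := def_ex hZ0
  have hmem : ∀ (w : VV l β → M) (y : B → M), w ∈ sec Z0 y ↔ KI E k l (fun i => w ∘ gg l i) ∧
      ∀ i < l, Sum.elim y (w ∘ gg l i) ∈ ψ := by
    intro w y
    simp only [sec, Z0, Set.mem_ofPred_eq, Set.mem_inter_iff, Set.mem_iInter, Set.mem_preimage]
    have e : ∀ i : ℕ, Sum.elim w y ∘ Sum.elim Sum.inr (Sum.inl ∘ gg l i) =
        Sum.elim y (w ∘ gg l i) := by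
      intro i; funext z; cases z <;> rfl
    simp only [e]
    exact and_congr Iff.rfl ⟨fun hh i hi => hh ⟨i, hi⟩, fun hh i => hh i i.2⟩
  by_cases hy : (fun x : B => (x : M)) ∈ Z
  · obtain ⟨w, hw⟩ := hy
    rw [hmem] at hw
    exact ⟨fun i => w ∘ gg l i, fun i hi => (swp_elim ψ0 _ _).1 (hw.2 i hi), hw.1⟩
  · exfalso
    let ψ' : Set (B ⊕ β → M) := ψ ∩ ((fun g => g ∘ Sum.inl) ⁻¹' Zᶜ)
    refine hU B ψ' (hψ.inter (hZ.compl.preimage_comp _)) (fun x : B => (x : M)) ?_ l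
      ⟨r, hr, fun n s hs hk => ?_⟩
    · filter_upwards [hθU] with n hn
      exact ⟨(swp_elim ψ0 _ _).2 hn, hy⟩
    · rintro ⟨y, hyy⟩
      obtain ⟨f, hf, hK'⟩ := ki_sub (hK n) s hs l hk.ge
      have hyZ : y ∉ Z := (hyy _ (hf 0 hl)).2
      refine hyZ ⟨vec l (fun i => r (f i)), (hmem _ _).2 ⟨hK'.congr fun i hi => vec_gg _ hi, ?_⟩⟩
      intro i hi
      rw [vec_gg _ hi]
      exact (hyy _ (hf i hi)).1

theorem core {N : Set M} (C : Ctx L N) {α β : Type u} [Finite α] [Finite β]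
    {a : β → M} {G : Set (α ⊕ β → M)} (hG : N.Definable L G) (h : Fk L N G a) :
    ∃ k, Dv L N G a k := by
  classical
  obtain ⟨ι, _, E, h1, h2, h3⟩ := h
  have := Fintype.ofFinite ι
  obtain ⟨U, hUa, hst⟩ := strict_exists C a
  have hU := coh_of_le hUa
  have hm : ∀ i, ∃ m, ¬ PP U (E i) m Set.univ := fun i => by
    obtain ⟨k, hk⟩ := h2 i
    exact good_pp C (h1 i) hU (kim (h1 i) hk hst)
  choose m hm using hm
  obtain ⟨c, hc⟩ := morley_exists C U
  have hac : ∀ j, Eqv L N a (c j) := fun j => eqv_of_rz hUa (hc j)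
  have hsub : ∀ j, ∀ x ∈ sec G (c j), ∃ i, x ∈ sec (E i) (c j) := by
    intro j x hx
    obtain ⟨σ, hσ, hσb⟩ := C.hom β a (c j) (hac j)
    have e : c j = fun i => σ (a i) := funext fun i => (hσb i).symm
    rw [e] at hx ⊢
    rw [aut_sec' hG σ hσ] at hx
    obtain ⟨i, hi⟩ := h3 _ hx
    exact ⟨i, (aut_sec' (h1 i) σ hσ x a).2 hi⟩
  -- sizes
  have hmono : ∀ i (f : ℕ → ℕ), StrictMono f → ¬ ∃ x, ∀ j < m i, x ∈ sec (E i) (c (f j)) := by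
    rintro i f hf ⟨x, hx⟩
    refine hm i ((pp_iff hU (h1 i) (fun j => c (f j)) (m i) (fun j _ => ?_) Set.univ
      Set.definable_univ).2 ⟨x, trivial, hx⟩)
    refine (hc (f j)).mono ?_
    rintro z ⟨i', hi', hz⟩
    exact ⟨f i', hf hi', hz⟩
  refine ⟨∑ i, m i + 1, c, hac, fun l s _ hk => ?_⟩
  rintro ⟨x, hx⟩
  have hne : Nonempty ι := by
    obtain ⟨j, hj⟩ : s.Nonempty := Finset.card_pos.1 (by omega)
    exact ⟨(hsub j x (hx j hj)).choose⟩
  choose! p hp using fun j (hj : j ∈ s) => hsub j x (hx j hj)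
  have : ∃ i, m i ≤ (s.filter (fun j => p j = i)).card := by
    by_contra! hlt
    have h1 : s.card = ∑ i, (s.filter (fun j => p j = i)).card :=
      Finset.card_eq_sum_card_fiberwise (fun _ _ => Finset.mem_coe.2 (Finset.mem_univ _))
    have h2 : ∑ i, (s.filter (fun j => p j = i)).card ≤ ∑ i, m i :=
      Finset.sum_le_sum fun i _ => (hlt i).le
    omega
  obtain ⟨i, hi⟩ := this
  let S := s.filter (fun j => p j = i)
  -- enumerate
  have hmem : ∀ j ∈ S, x ∈ sec (E i) (c j) := fun j hj => by
    have hj' := Finset.mem_filter.1 hj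
    have := hp j hj'.1
    rwa [hj'.2] at this
  let f : ℕ → ℕ := fun j => if hj : j < S.card then S.orderEmbOfFin rfl ⟨j, hj⟩
    else S.sup id + 1 + j
  have hf : StrictMono f := by
    intro j j' hjj
    by_cases h2 : j' < S.card
    · have h1 : j < S.card := by omega
      simp only [f, h1, h2, dite_true]
      exact (S.orderEmbOfFin rfl).strictMono hjj
    · by_cases h1 : j < S.card
      · simp only [f, h1, h2, dite_true, dite_false]
        have : S.orderEmbOfFin rfl ⟨j, h1⟩ ≤ S.sup id :=
          Finset.le_sup (f := id) (Finset.orderEmbOfFin_mem S rfl _)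
        omega
      · simp only [f, h1, h2, dite_false]
        omega
  refine hmono i f hf ⟨x, fun j hj => ?_⟩
  have hjS : j < S.card := lt_of_lt_of_le hj hi
  have : f j ∈ S := by
    simp only [f, hjS, dite_true]
    exact Finset.orderEmbOfFin_mem S rfl _
  exact hmem _ this

end Core

section Core
variable {L} {M}

theorem tv_holds (N : L.ElementarySubstructure M) (γ : Type u) [Finite γ] (D : Set (γ → M))
    (hD : (N : Set M).Definable L D) (hne : D.Nonempty) : ∃ y ∈ D, ∀ i, y i ∈ (N : Set M) := by
  rw [Set.definable_iff_exists_formula_sum] at hD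
  obtain ⟨φ, rfl⟩ := hD
  obtain ⟨x, hx⟩ := hne
  have h1 : (φ.iExs γ).Realize (fun c : (N : Set M) => (c : M)) := by
    rw [Language.Formula.realize_iExs]
    exact ⟨x, hx⟩
  have h2 : (φ.iExs γ).Realize (fun c : N => c) := by
    rw [← N.subtype.map_formula]
    exact h1
  rw [Language.Formula.realize_iExs] at h2
  obtain ⟨y, hy⟩ := h2
  rw [← N.subtype.map_formula] at hy
  refine ⟨fun i => (y i : M), ?_, fun i => (y i).2⟩
  change φ.Realize _
  refine (iff_of_eq (congrArg _ ?_)).1 hy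
  funext z
  cases z <;> rfl

theorem def_nat {A : Set M} (hne : A.Nonempty) {ι : Type u} {D : Set (ι → M)}
    (hD : A.Definable L D) : ∃ (φ : L.Formula (ι ⊕ ℕ)) (p : ℕ → M), Set.range p ⊆ A ∧
      ∀ v : ι → M, v ∈ D ↔ φ.Realize (Sum.elim v p) := by
  obtain ⟨a0, ha0⟩ := hne
  obtain ⟨A0, hA0, hD0⟩ := Set.definable_iff_finitely_definable.1 hD
  rw [Set.definable_iff_exists_formula_sum] at hD0
  obtain ⟨φ, rfl⟩ := hD0
  let e := A0.equivFin
  let p : ℕ → M := fun i => if hi : i < A0.card then (e.symm ⟨i, hi⟩ : M) else a0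
  refine ⟨φ.relabel (fun z => match z with
    | Sum.inl c => Sum.inr ((e ⟨c.1, c.2⟩ : Fin _) : ℕ)
    | Sum.inr x => Sum.inl x), p, ?_, fun v => ?_⟩
  · rintro _ ⟨i, rfl⟩
    by_cases hi : i < A0.card
    · simp only [p, hi, dite_true]
      exact hA0 (e.symm ⟨i, hi⟩).2
    · simpa only [p, hi, dite_false] using ha0
  · simp only [Set.mem_ofPred_eq, Language.Formula.realize_relabel]
    refine iff_of_eq (congrArg _ ?_)
    funext z
    rcases z with c | x
    · simp [p]
    · rfl

theorem gsat {κ : Cardinal.{u}} (hM : IsMonster L M κ) {A : Set M} (hA : Cardinal.mk A < κ)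
    (hne : A.Nonempty) {ι : Type u} (hι : Cardinal.mk ι < κ) (F : Set (Set (ι → M)))
    (hF : ∀ D ∈ F, A.Definable L D) (hfip : ∀ T ⊆ F, T.Finite → (⋂₀ T).Nonempty) :
    (⋂₀ F).Nonempty := by
  let S : Set (L.Formula (ι ⊕ ℕ) × (ℕ → M)) := {q | Set.range q.2 ⊆ A ∧
    {v : ι → M | q.1.Realize (Sum.elim v q.2)} ∈ F}
  obtain ⟨x, hx⟩ := hM.saturated A hA ι hι S (fun q hq => hq.1) (by
    intro l hl
    obtain ⟨x, hx⟩ := hfip ((fun q : L.Formula (ι ⊕ ℕ) × (ℕ → M) =>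
      {v : ι → M | q.1.Realize (Sum.elim v q.2)}) '' {q | q ∈ l}) (by
        rintro _ ⟨q, hq, rfl⟩
        exact (hl q hq).2) ((List.finite_toSet l).image _)
    exact ⟨x, fun q hq => hx _ ⟨q, hq, rfl⟩⟩)
  refine ⟨x, fun D hD => ?_⟩
  obtain ⟨φ, p, hp, hv⟩ := def_nat hne (hF D hD)
  have e : {v : ι → M | φ.Realize (Sum.elim v p)} = D := by
    ext v; exact (hv v).symm
  exact (hv x).2 (hx (φ, p) ⟨hp, by change {v : ι → M | φ.Realize (Sum.elim v p)} ∈ F; rw [e]; exact hD⟩)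

theorem def_real {A : Set M} {δ : Type u} {γ : Type u} (φ : L.Formula (δ ⊕ γ)) (c : γ → M)
    (hc : Set.range c ⊆ A) : A.Definable L {v : δ → M | φ.Realize (Sum.elim v c)} := by
  have h : A.Definable L {g : δ ⊕ γ → M | φ.Realize g} :=
    Set.Definable.mono (Set.empty_definable_iff.2 ⟨φ, rfl⟩) (Set.empty_subset _)
  exact def_sec h c (fun i => hc ⟨i, rfl⟩)

theorem eqv_eqType {A : Set M} {δ : Type u} {a b : δ → M} (h : Eqv L A a b) :
    EqTypeOver L M A a b := fun _ φ c hc => h.iff (def_real φ c hc)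

theorem eqType_eqv {A : Set M} {δ : Type u} {a b : δ → M} (h : EqTypeOver L M A a b) :
    Eqv L A a b := by
  intro D hD ha
  rw [Set.definable_iff_exists_formula_sum] at hD
  obtain ⟨φ, rfl⟩ := hD
  have := h A (φ.relabel Sum.swap) (fun x => x) (by simp)
  simp only [Language.Formula.realize_relabel] at this
  have e : ∀ v : δ → M, Sum.elim v (fun x : A => (x : M)) ∘ Sum.swap = Sum.elim (fun x : A => (x : M)) v := by
    intro v; funext z; cases z <;> rfl
  rw [e, e] at this
  exact this.1 ha

theorem fin_lt {κ : Cardinal.{u}} (hM : IsMonster L M κ) (γ : Type u) [Countable γ] :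
    Cardinal.mk γ < κ := lt_of_le_of_lt (Cardinal.mk_le_aleph0) hM.aleph0_lt

theorem union_lt {κ : Cardinal.{u}} (hM : IsMonster L M κ) {A B : Set M}
    (hA : Cardinal.mk A < κ) (hB : B.Countable) : Cardinal.mk ↥(A ∪ B) < κ := by
  have : Countable B := hB
  exact lt_of_le_of_lt (Cardinal.mk_union_le _ _)
    (Cardinal.add_lt_of_lt hM.aleph0_lt.le hA (fin_lt hM B))

theorem ntp2_holds {κ : Cardinal.{u}} (hM : IsMonster L M κ) (hT : NTP2 L M) {N : Set M}
    (hN : Cardinal.mk N < κ) (hne : N.Nonempty) (α β : Type u) [Finite α] [Finite β]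
    (E : Set (α ⊕ β → M)) (hE : N.Definable L E) (k : ℕ) :
    ¬ ∀ m l : ℕ, ∃ a : ℕ → ℕ → β → M, (∀ j < m, KI E k l (a j)) ∧
      ∀ f : ℕ → ℕ, (∀ j < m, f j < l) → ∃ x : α → M, ∀ j < m, x ∈ sec E (a j (f j)) := by
  intro hall
  let V : Type u := ULift.{u} (ℕ × ℕ) × β
  let g : ℕ → ℕ → β → V := fun j i b => (⟨(j, i)⟩, b)
  let F1 : Set (Set (V → M)) := {D | ∃ (j : ℕ) (s : Finset ℕ), s.card = k ∧
    D = {w : V → M | ∃ x : α → M, ∀ i ∈ s, x ∈ sec E (fun b => w (g j i b))}ᶜ}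
  let F2 : Set (Set (V → M)) := {D | ∃ (m : ℕ) (f : ℕ → ℕ),
    D = {w : V → M | ∃ x : α → M, ∀ j ∈ Finset.range m, x ∈ sec E (fun b => w (g j (f j) b))}}
  have key : ∀ T ⊆ F1 ∪ F2, T.Finite → ∃ m l : ℕ, ∀ m' ≥ m, ∀ l' ≥ l, ∀ a : ℕ → ℕ → β → M,
      (∀ j < m', KI E k l' (a j)) →
      (∀ f : ℕ → ℕ, (∀ j < m', f j < l') → ∃ x : α → M, ∀ j < m', x ∈ sec E (a j (f j))) →
      ∀ D ∈ T, (fun z : V => a z.1.down.1 z.1.down.2 z.2) ∈ D := by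
    intro T hT hf
    induction T, hf using Set.Finite.induction_on with
    | empty => exact ⟨0, 0, by simp⟩
    | @insert D T _ _ ih =>
      obtain ⟨m, l, h⟩ := ih (fun x hx => hT (Set.mem_insert_of_mem _ hx))
      rcases hT (Set.mem_insert D T) with ⟨j, s, hk, rfl⟩ | ⟨m0, f, rfl⟩
      · refine ⟨max m (j+1), max l (s.sup id + 1), fun m' hm l' hl a h1 h2 D hD => ?_⟩
        rcases hD with rfl | hD
        · refine h1 j (by omega) s (fun i hi => ?_) hk
          have : i ≤ s.sup id := Finset.le_sup (f := id) hi
          omega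
        · exact h m' (by omega) l' (by omega) a h1 h2 D hD
      · refine ⟨max m m0, max l ((Finset.range m0).sup f + 1), fun m' hm l' hl a h1 h2 D hD => ?_⟩
        rcases hD with rfl | hD
        · obtain ⟨x, hx⟩ := h2 (fun j => if j < m0 then f j else 0) (fun j _ => by
            by_cases hj : j < m0
            · have : f j ≤ (Finset.range m0).sup f := Finset.le_sup (Finset.mem_range.2 hj)
              simp only [hj, if_true]; omega
            · simp only [hj, if_false]; omega)
          refine ⟨x, fun j hj => ?_⟩
          have hj' := Finset.mem_range.1 hj
          have := hx j (by omega)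
          simp only [hj', if_true] at this
          exact this
        · exact h m' (by omega) l' (by omega) a h1 h2 D hD
  obtain ⟨w, hw⟩ := gsat hM hN hne (fin_lt hM V) (F1 ∪ F2) (by
    rintro D (⟨j, s, _, rfl⟩ | ⟨m, f, rfl⟩)
    · exact (def_fin hE (g j) s).compl
    · exact def_fin hE (fun j => g j (f j)) _) (by
    intro T hT hf
    obtain ⟨m, l, h⟩ := key T hT hf
    obtain ⟨a, h1, h2⟩ := hall m l
    exact ⟨_, h m le_rfl l le_rfl a h1 h2⟩)
  let z : ℕ → ℕ → β → M := fun j i b => w (g j i b)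
  have hpath : ∀ f : ℕ → ℕ, ∃ x : α → M, ∀ j, x ∈ sec E (z j (f j)) := by
    intro f
    have hA : Cardinal.mk ↥(N ∪ Set.range w) < κ := union_lt hM hN (Set.countable_range w)
    obtain ⟨x, hx⟩ := gsat hM hA (hne.mono Set.subset_union_left) (fin_lt hM α)
      (Set.range fun j => sec E (z j (f j))) (by
        rintro _ ⟨j, rfl⟩
        exact def_sec (hE.mono Set.subset_union_left) _ (fun b => Or.inr ⟨_, rfl⟩)) (by
        intro T hT hf
        have : ∃ m, ∀ D ∈ T, ∃ j < m, D = sec E (z j (f j)) := by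
          induction T, hf using Set.Finite.induction_on with
          | empty => exact ⟨0, by simp⟩
          | @insert D T _ _ ih =>
            obtain ⟨m, h⟩ := ih (fun x hx => hT (Set.mem_insert_of_mem _ hx))
            obtain ⟨j, rfl⟩ := hT (Set.mem_insert D T)
            refine ⟨max m (j+1), fun D hD => ?_⟩
            rcases hD with rfl | hD
            · exact ⟨j, by omega, rfl⟩
            · obtain ⟨i, hi, h'⟩ := h D hD
              exact ⟨i, by omega, h'⟩
        obtain ⟨m, hm⟩ := this
        obtain ⟨x, hx⟩ := hw _ (Or.inr ⟨m, f, rfl⟩)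
        refine ⟨x, fun D hD => ?_⟩
        obtain ⟨j, hj, rfl⟩ := hm D hD
        exact hx j (Finset.mem_range.2 hj))
    exact ⟨x, fun j => hx _ ⟨j, rfl⟩⟩
  obtain ⟨A0, hA0, hE0⟩ := Set.definable_iff_finitely_definable.1 hE
  rw [Set.definable_iff_exists_formula_sum] at hE0
  obtain ⟨φ, rfl⟩ := hE0
  obtain ⟨n, ⟨e⟩⟩ := Finite.exists_equiv_fin α
  obtain ⟨m, ⟨e'⟩⟩ := Finite.exists_equiv_fin (↥(A0 : Set M) ⊕ β)
  let φ' : L.Formula (Fin n ⊕ Fin m) := φ.relabel (fun q => match q with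
    | Sum.inl c => Sum.inr (e' (Sum.inl c))
    | Sum.inr (Sum.inl x) => Sum.inl (e x)
    | Sum.inr (Sum.inr b) => Sum.inr (e' (Sum.inr b)))
  let a : ℕ → ℕ → Fin m → M := fun i j =>
    Sum.elim (fun c : (A0 : Set M) => (c : M)) (z j i) ∘ e'.symm
  have hr : ∀ (x : Fin n → M) i j, φ'.Realize (Sum.elim x (a i j)) ↔
      x ∘ e ∈ sec {v : α ⊕ β → M | φ.Realize (Sum.elim (fun c : (A0 : Set M) => (c : M)) v)}
        (z j i) := by
    intro x i j
    simp only [φ', sec, Set.mem_ofPred_eq, Language.Formula.realize_relabel]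
    refine iff_of_eq (congrArg _ ?_)
    funext q
    rcases q with c | x | b <;> simp [a]
  refine hT ⟨n, m, k, φ', a, fun j s hk => ?_, fun f => ?_⟩
  · rintro ⟨x, hx⟩
    exact hw _ (Or.inl ⟨j, s, hk, rfl⟩) ⟨x ∘ e, fun i hi => (hr x i j).1 (hx i hi)⟩
  · obtain ⟨x, hx⟩ := hpath f
    refine ⟨x ∘ e.symm, fun j => (hr _ _ _).2 ?_⟩
    have : (x ∘ e.symm) ∘ e = x := by funext i; simp
    rw [this]
    exact hx j

theorem ctx_holds {κ : Cardinal.{u}} (hM : IsMonster L M κ) (hT : NTP2 L M)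
    (N : L.ElementarySubstructure M) (hN : Cardinal.mk (N : Set M) < κ)
    (hne : (N : Set M).Nonempty) : Ctx L (N : Set M) where
  tv := fun γ _ D hD h => tv_holds N γ D hD h
  sat := fun γ _ B hB F hF hfip => gsat hM (union_lt hM hN hB.countable)
    (hne.mono Set.subset_union_left) (fin_lt hM γ) F hF hfip
  hom := fun γ _ a b h => hM.homogeneous N hN γ (fin_lt hM γ) a b (eqv_eqType h)
  ntp2 := fun α β _ _ E hE k => ntp2_holds hM hT hN hne α β E hE k

end Core

section Core
variable {L} {M}

theorem restr {A : Set M} {α β Γ : Type u} [DecidableEq (α ⊕ β)] (φ : L.Formula (α ⊕ β))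
    (α0 : Set α)
    (h : ∀ x, Sum.inl x ∈ Language.BoundedFormula.freeVarFinset φ → x ∈ α0)
    (q : {b : β // Sum.inr b ∈ Language.BoundedFormula.freeVarFinset φ} → Γ) :
    ∃ G : Set (α0 ⊕ Γ → M), A.Definable L G ∧ ∀ (x : α → M) (b : β → M) (w : Γ → M),
      (∀ b', w (q b') = b b'.1) →
      ((fun i : α0 => x i) ∈ sec G w ↔ φ.Realize (Sum.elim x b)) := by
  let f : Language.BoundedFormula.freeVarFinset φ → α0 ⊕ Γ := fun z => match z with
    | ⟨Sum.inl x, hx⟩ => Sum.inl ⟨x, h x hx⟩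
    | ⟨Sum.inr b, hb⟩ => Sum.inr (q ⟨b, hb⟩)
  let φ' : L.Formula (α0 ⊕ Γ) := Language.BoundedFormula.restrictFreeVar φ f
  refine ⟨{g | φ'.Realize g}, Set.Definable.mono (Set.empty_definable_iff.2 ⟨φ', rfl⟩)
    (Set.empty_subset _), fun x b w hw => ?_⟩
  refine Language.BoundedFormula.realize_restrictFreeVar _ ?_
  rintro ⟨x | b, hz⟩
  · rfl
  · exact hw ⟨b, hz⟩

theorem forks_divides {κ : Cardinal.{u}} (hM : IsMonster L M κ) (hT : NTP2 L M)
    (N : L.ElementarySubstructure M) (hN : Cardinal.mk (N : Set M) < κ) (m0 : M)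
    {α β : Type u} (φ : L.Formula (α ⊕ β)) (a : β → M)
    (h : Forks L M (N : Set M) φ a) : Divides L M (N : Set M) φ a := by
  classical
  have hne : (N : Set M).Nonempty := by
    obtain ⟨y, _, hy⟩ := tv_holds N PUnit Set.univ Set.definable_univ ⟨fun _ => m0, trivial⟩
    exact ⟨_, hy PUnit.unit⟩
  have C := ctx_holds hM hT N hN hne
  obtain ⟨n, γ, ψ, c, hdiv, hcov⟩ := h
  let α0 : Set α := {x | Sum.inl x ∈ Language.BoundedFormula.freeVarFinset φ} ∪
    ⋃ i, {x | Sum.inl x ∈ Language.BoundedFormula.freeVarFinset (ψ i)}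
  have hα0 : α0.Finite := by
    refine Set.Finite.union ?_ (Set.finite_iUnion fun i => ?_)
    · exact (Finset.finite_toSet _).preimage Sum.inl_injective.injOn
    · exact (Finset.finite_toSet (Language.BoundedFormula.freeVarFinset (ψ i))).preimage
        Sum.inl_injective.injOn
  let β0 : Type u := {b : β // Sum.inr b ∈ Language.BoundedFormula.freeVarFinset φ}
  let γ0 : Fin n → Type u := fun i =>
    {b : γ i // Sum.inr b ∈ Language.BoundedFormula.freeVarFinset (ψ i)}
  have fα : Finite α0 := hα0
  have fβ : Finite β0 :=
    (Finset.finite_toSet (Language.BoundedFormula.freeVarFinset φ)).preimage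
      Sum.inr_injective.injOn
  have fγ : ∀ i, Finite (γ0 i) := fun i =>
    (Finset.finite_toSet (Language.BoundedFormula.freeVarFinset (ψ i))).preimage
      Sum.inr_injective.injOn
  let Γ : Type u := β0 ⊕ (Σ i, γ0 i)
  have fΓ : Finite Γ := inferInstance
  obtain ⟨G, hG, hGr⟩ := restr (M := M) (A := (N : Set M)) (Γ := Γ) φ α0
    (fun x hx => Or.inl hx) Sum.inl
  choose E hE hEr using fun i => restr (M := M) (A := (N : Set M)) (Γ := Γ) (ψ i) α0
    (fun x hx => Or.inr (Set.mem_iUnion.2 ⟨i, hx⟩)) (fun p => Sum.inr ⟨i, p⟩)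
  let cc : Γ → M := Sum.elim (fun b => a b.1) (fun p => c p.1 p.2.1)
  have hext : ∀ y : α0 → M, ∃ x : α → M, (fun i : α0 => x i) = y := fun y =>
    ⟨fun i => if hi : i ∈ α0 then y ⟨i, hi⟩ else m0, by funext i; simp⟩
  have hFk : Fk L (N : Set M) G cc := by
    refine ⟨Fin n, inferInstance, E, hE, fun i => ?_, fun y hy => ?_⟩
    · obtain ⟨k, bs, hbs, hK⟩ := hdiv i
      have hσ : ∀ l, ∃ σ : M ≃[L] M, FixesSet L M σ (N : Set M) ∧
          ∀ p : γ0 i, σ (c i p.1) = bs l p.1 := fun l =>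
        C.hom (γ0 i) (fun p => c i p.1) (fun p => bs l p.1)
          (((eqType_eqv (hbs l)).symm).comp (Subtype.val : γ0 i → γ i))
      choose σ hσ1 hσ2 using hσ
      refine ⟨k, fun l p => σ l (cc p), fun l => eqv_aut (σ l) (hσ1 l) cc, fun l s _ hk => ?_⟩
      rintro ⟨y, hy⟩
      obtain ⟨x, rfl⟩ := hext y
      exact hK s hk ⟨x, fun j hj => (hEr i x (bs j) _ (fun p => hσ2 j p)).1 (hy j hj)⟩
    · obtain ⟨x, rfl⟩ := hext y
      obtain ⟨i, hi⟩ := hcov x ((hGr x a cc (fun _ => rfl)).1 hy)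
      exact ⟨i, (hEr i x (c i) cc (fun _ => rfl)).2 hi⟩
  obtain ⟨k, r, hr, hK⟩ := core C hG hFk
  choose σ hσ1 hσ2 using fun l => C.hom Γ cc (r l) (hr l)
  refine ⟨k, fun l b => σ l (a b), fun l => eqv_eqType (eqv_aut (σ l) (hσ1 l) a).symm,
    fun s hk => ?_⟩
  rintro ⟨x, hx⟩
  refine hK (s.sup id + 1) s (fun i hi => ?_) hk ⟨fun i => x i, fun i hi => ?_⟩
  · have : i ≤ s.sup id := Finset.le_sup (f := id) hi
    omega
  · refine (hGr x (fun b => σ i (a b)) (r i) (fun b' => ?_)).2 (hx i hi)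
    exact (hσ2 i (Sum.inl b')).symm

theorem forks_divides_empty [IsEmpty M] (N : Set M) {α β : Type u} (φ : L.Formula (α ⊕ β))
    (a : β → M) (h : Forks L M N φ a) : Divides L M N φ a := by
  obtain ⟨n, γ, ψ, c, hdiv, hcov⟩ := h
  by_cases hx : ∃ x : α → M, φ.Realize (Sum.elim x a)
  · exfalso
    obtain ⟨x, hx⟩ := hx
    obtain ⟨i, hi⟩ := hcov x hx
    obtain ⟨k, bs, _, hK⟩ := hdiv i
    refine hK (Finset.range k) (by simp) ⟨x, fun j _ => ?_⟩
    have : bs j = c i := funext fun p => isEmptyElim (c i p)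
    rwa [this]
  · refine ⟨1, fun _ => a, fun _ _ _ _ _ => Iff.rfl, fun s hs => ?_⟩
    rintro ⟨x, hxs⟩
    obtain ⟨i, hi⟩ : s.Nonempty := Finset.card_pos.1 (by omega)
    exact hx ⟨x, hxs i hi⟩

end Core


/-- In an NTP₂ theory, forking and dividing over a small model
coincide. -/
theorem forking_eq_dividing_over_models
    (κ : Cardinal.{u}) (hM : IsMonster L M κ) (hT : NTP2 L M)
    (N : L.ElementarySubstructure M) (hN : Cardinal.mk (N : Set M) < κ)
    {α β : Type u} (φ : L.Formula (α ⊕ β)) (a : β → M) :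
    Forks L M (N : Set M) φ a ↔ Divides L M (N : Set M) φ a := by
  constructor
  · intro h
    rcases isEmpty_or_nonempty M with hE | ⟨⟨m0⟩⟩
    · exact forks_divides_empty _ φ a h
    · exact forks_divides hM hT N hN m0 φ a h
  · intro h
    exact ⟨1, fun _ => β, fun _ => φ, fun _ => a, fun _ => h, fun x hx => ⟨0, hx⟩⟩

end ForkingNTP2
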